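/- An irrational real number ξ with continued fraction expansion ξ = [a₀, a₁, a₂, …] is extremal with an associated Fibonacci sequence in 𝒫 all of whose terms lie in GL₂(ℤ) if and only if there exist a Fibonacci sequence of words (w_i)_{i≥1} over the alphabet of positive integers whose first two terms w₁ and w₂ do not commute (w₁w₂ ≠ w₂w₁), with limit word b₁b₂b₃… = lim_{i→∞} w_i, and integers k, ℓ ≥ 0 such that a_{k+i} = b_{ℓ+i} for all i ≥ 1. -/

import Mathlib

open Matrix

/-- 2×2 integer matrices. -/
abbrev M2 : Type := Matrix (Fin 2) (Fin 2) ℤ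

/-- The content of an integer matrix: the gcd of its coefficients. -/
def content (A : M2) : ℕ :=
  Nat.gcd (Nat.gcd (A 0 0).natAbs (A 0 1).natAbs) (Nat.gcd (A 1 0).natAbs (A 1 1).natAbs)

/-- A matrix is primitive if its content is 1. -/
def Primitive (A : M2) : Prop := content A = 1

/-- Membership in 𝒫: primitive with nonzero determinant. -/
def MemP (A : M2) : Prop := Primitive A ∧ A.det ≠ 0

/-- `A^red`: the primitive matrix such that `A = content A • A^red`. -/
def red (A : M2) : M2 := Matrix.of fun i j => A i j / (content A : ℤ)

/-- The group operation of 𝒫: `A * B = (AB)^red`. -/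
def pmul (A B : M2) : M2 := red (A * B)

/-- A Fibonacci sequence in 𝒫 (indices from 1). -/
def IsFibP (W : ℕ → M2) : Prop :=
  (∀ i, 1 ≤ i → MemP (W i)) ∧ ∀ i, 1 ≤ i → W (i + 2) = pmul (W (i + 1)) (W i)

/-- Admissibility of a Fibonacci sequence in 𝒫: there is a non-symmetric,
non-skew-symmetric N ∈ 𝒫 such that W_i N_i is symmetric for all i ≥ 1,
where N_i = ᵗN for odd i and N_i = N for even i. -/
def AdmissibleFib (W : ℕ → M2) : Prop :=
  ∃ N : M2, MemP N ∧ N ≠ Nᵀ ∧ N ≠ -Nᵀ ∧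
    ∀ i, 1 ≤ i → (W i * (if i % 2 = 1 then Nᵀ else N)).IsSymm

/-- The norm of an integer 2×2 matrix: max absolute value of coefficients, as a real. -/
noncomputable def mnorm (A : M2) : ℝ :=
  max (max |(A 0 0 : ℝ)| |(A 0 1 : ℝ)|) (max |(A 1 0 : ℝ)| |(A 1 1 : ℝ)|)

/-- The sequence is unbounded in norm. -/
def UnboundedSeq (W : ℕ → M2) : Prop := ∀ C : ℝ, ∃ i, 1 ≤ i ∧ C < mnorm (W i)

/-- The golden ratio γ = (1+√5)/2. -/
noncomputable def gam : ℝ := (1 + Real.sqrt 5) / 2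

/-- Norm of the row vector (ξ, -1)·A. -/
noncomputable def xiNorm (ξ : ℝ) (A : M2) : ℝ :=
  max |ξ * (A 0 0 : ℝ) - (A 1 0 : ℝ)| |ξ * (A 0 1 : ℝ) - (A 1 1 : ℝ)|

/-- ξ is extremal: neither rational nor quadratic over ℚ, and for each X ≥ 1 the system
|x₀| ≤ X, |x₀ξ - x₁| ≤ c X^(-1/γ), |x₀ξ² - x₂| ≤ c X^(-1/γ) has a nonzero integer solution. -/
def IsExtremal (ξ : ℝ) : Prop :=
  (∀ a b c : ℚ, ¬(a = 0 ∧ b = 0 ∧ c = 0) → (a : ℝ) * ξ ^ 2 + (b : ℝ) * ξ + (c : ℝ) ≠ 0) ∧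
  ∃ c : ℝ, 0 < c ∧ ∀ X : ℝ, 1 ≤ X → ∃ x₀ x₁ x₂ : ℤ,
    ¬(x₀ = 0 ∧ x₁ = 0 ∧ x₂ = 0) ∧ |(x₀ : ℝ)| ≤ X ∧
    |(x₀ : ℝ) * ξ - (x₁ : ℝ)| ≤ c * X ^ (-1 / gam) ∧
    |(x₀ : ℝ) * ξ ^ 2 - (x₂ : ℝ)| ≤ c * X ^ (-1 / gam)

/-- The Fibonacci sequence `W` in 𝒫 is associated to the extremal real number ξ:
it is an unbounded admissible Fibonacci sequence in 𝒫 with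
‖W_{i+1}‖ ≍ ‖W_i‖^γ, ‖(ξ,-1)W_i‖ ≍ ‖W_i‖⁻¹ and |det W_i| ≍ 1. -/
def IsAssociated (ξ : ℝ) (W : ℕ → M2) : Prop :=
  IsFibP W ∧ UnboundedSeq W ∧ AdmissibleFib W ∧
  ∃ c₁ c₂ c₃ c₄ c₅ c₆ : ℝ, 0 < c₁ ∧ 0 < c₂ ∧ 0 < c₃ ∧ 0 < c₄ ∧ 0 < c₅ ∧ 0 < c₆ ∧
    ∀ i, 1 ≤ i →
      c₁ * mnorm (W i) ^ gam ≤ mnorm (W (i + 1)) ∧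
      mnorm (W (i + 1)) ≤ c₂ * mnorm (W i) ^ gam ∧
      c₃ * (mnorm (W i))⁻¹ ≤ xiNorm ξ (W i) ∧
      xiNorm ξ (W i) ≤ c₄ * (mnorm (W i))⁻¹ ∧
      c₅ ≤ |((W i).det : ℝ)| ∧ |((W i).det : ℝ)| ≤ c₆

/-- Membership in GL₂(ℤ): integer matrix of determinant ±1. -/
def InGL2Z (A : M2) : Prop := A.det = 1 ∨ A.det = -1

/-- ξ is badly approximable: irrational and |ξ - p/q| > c/q² for all rationals p/q. -/
def BadlyApprox (ξ : ℝ) : Prop :=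
  Irrational ξ ∧ ∃ c : ℝ, 0 < c ∧ ∀ p q : ℤ, q ≠ 0 → c / (q : ℝ) ^ 2 < |ξ - (p : ℝ) / (q : ℝ)|

/-- Partial quotients of the continued fraction expansion: `cfA n ξ` is `aₙ`
where ξ = [a₀, a₁, a₂, …]. -/
noncomputable def cfA : ℕ → ℝ → ℤ
  | 0, ξ => ⌊ξ⌋
  | n + 1, ξ => cfA n (ξ - ⌊ξ⌋)⁻¹

/-- A Fibonacci sequence of words (indices from 1). -/
def FibWordSeq {α : Type} (w : ℕ → List α) : Prop := ∀ i, 1 ≤ i → w (i + 2) = w (i + 1) ++ w i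

/-- `b` (indexed from 1: the limit word is b₁b₂b₃…) is the infinite limit word of the
sequence of words `w`: every `w k` (k ≥ 2) is a prefix of it, and their lengths are unbounded. -/
def IsLimitWord {α : Type} (w : ℕ → List α) (b : ℕ → α) : Prop :=
  (∀ n : ℕ, ∃ k, 2 ≤ k ∧ n ≤ (w k).length) ∧
  ∀ k, 2 ≤ k → ∀ j, (h : j < (w k).length) → (w k).get ⟨j, h⟩ = b (j + 1)

/-- The Fibonacci sequence of words over the alphabet E = {a, b} (with `b = false`,
`a = true`): w₁ = b, w₂ = a, w_{k+2} = w_{k+1} w_k.  Its limit is f_{a,b}. -/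
def fw : ℕ → List Bool
  | 0 => []
  | 1 => [false]
  | 2 => [true]
  | n + 3 => fw (n + 2) ++ fw (n + 1)

/-- The prefix of length `i` of the infinite Fibonacci word `f_{a,b}`
(note `fw (i+2)` is a prefix of `f_{a,b}` of length ≥ i). -/
def fpref (i : ℕ) : List Bool := (fw (i + 2)).take i

/-- The monoid morphism Φ : E* → (𝒫, *) with Φ(b) = W₁, Φ(a) = W₂
(the letter `b` is `false` and `a` is `true`). -/
def PhiW (W1 W2 : M2) : List Bool → M2
  | [] => 1
  | x :: u => pmul (if x then W2 else W1) (PhiW W1 W2 u)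

/-- The set 𝒮₁ of real matrices (a b; c d) with a ≥ max{b,c} and min{b,c} ≥ d ≥ 0. -/
def S1 : Set (Matrix (Fin 2) (Fin 2) ℝ) :=
  {A | max (A 0 1) (A 1 0) ≤ A 0 0 ∧ A 1 1 ≤ min (A 0 1) (A 1 0) ∧ 0 ≤ A 1 1}

/-- The set 𝒮 = 𝒮₁ ∩ GL₂(ℤ), viewed as a set of integer matrices. -/
def Sset : Set M2 :=
  {A | (A.map (Int.cast : ℤ → ℝ)) ∈ S1 ∧ (A.det = 1 ∨ A.det = -1)}

/-- ξ is an extremal real number with an associated Fibonacci sequence in GL₂(ℤ). -/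
def HasGLAssoc (ξ : ℝ) : Prop :=
  IsExtremal ξ ∧ ∃ W : ℕ → M2, IsAssociated ξ W ∧ ∀ i, 1 ≤ i → InGL2Z (W i)

/-- ξ is an extremal real number with an associated Fibonacci sequence in 𝒮. -/
def HasSAssoc (ξ : ℝ) : Prop :=
  IsExtremal ξ ∧ ∃ W : ℕ → M2, IsAssociated ξ W ∧ ∀ i, 1 ≤ i → W i ∈ Sset

/-! ### Unimodular and primitive matrices -/

theorem content_dvd (A : M2) (i j : Fin 2) : (content A : ℤ) ∣ A i j := by
  rw [Int.natCast_dvd]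
  unfold content
  fin_cases i <;> fin_cases j
  · exact (Nat.gcd_dvd_left _ _).trans (Nat.gcd_dvd_left _ _)
  · exact (Nat.gcd_dvd_left _ _).trans (Nat.gcd_dvd_right _ _)
  · exact (Nat.gcd_dvd_right _ _).trans (Nat.gcd_dvd_left _ _)
  · exact (Nat.gcd_dvd_right _ _).trans (Nat.gcd_dvd_right _ _)

theorem dvd_content {A : M2} {e : ℕ} (h : ∀ i j, (e : ℤ) ∣ A i j) : e ∣ content A := by
  have h' : ∀ i j, e ∣ (A i j).natAbs := fun i j => Int.natCast_dvd.1 (h i j)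
  exact Nat.dvd_gcd (Nat.dvd_gcd (h' _ _) (h' _ _)) (Nat.dvd_gcd (h' _ _) (h' _ _))

theorem InGL2Z.content_eq_one {A : M2} (h : InGL2Z A) : content A = 1 := by
  have hd : (content A : ℤ) ∣ A.det := by
    rw [Matrix.det_fin_two]
    exact dvd_sub ((content_dvd A 0 0).mul_right _) ((content_dvd A 0 1).mul_right _)
  have h1 : (content A : ℤ) ∣ 1 := by
    rcases h with h | h
    · rwa [h] at hd
    · rw [h] at hd; exact (dvd_neg.1 hd)
  exact_mod_cast Int.eq_one_of_dvd_one (by positivity) h1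

theorem red_of_content_eq_one {A : M2} (h : content A = 1) : red A = A := by
  ext i j
  simp [red, h]

theorem InGL2Z.memP {A : M2} (h : InGL2Z A) : MemP A :=
  ⟨h.content_eq_one, by rcases h with h | h <;> rw [h] <;> norm_num⟩

theorem InGL2Z.mul {A B : M2} (hA : InGL2Z A) (hB : InGL2Z B) : InGL2Z (A * B) := by
  unfold InGL2Z at *
  rw [Matrix.det_mul]
  rcases hA with h | h <;> rcases hB with h' | h' <;> rw [h, h'] <;> norm_num

theorem pmul_of_inGL2Z {A B : M2} (hA : InGL2Z A) (hB : InGL2Z B) : pmul A B = A * B :=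
  red_of_content_eq_one (hA.mul hB).content_eq_one

theorem InGL2Z.abs_det {A : M2} (h : InGL2Z A) : |(A.det : ℝ)| = 1 := by
  rcases h with h | h <;> rw [h] <;> norm_num

theorem InGL2Z.det_mul_self {A : M2} (h : InGL2Z A) : A.det * A.det = 1 := by
  rcases h with h | h <;> rw [h] <;> norm_num

/-- A matrix with nonzero determinant is a nonzero multiple of a primitive matrix. -/
theorem exists_primitive_smul {N : M2} (hN : N.det ≠ 0) :
    ∃ (k : ℤ) (N' : M2), k ≠ 0 ∧ MemP N' ∧ N = k • N' := by
  have hc : (content N : ℤ) ≠ 0 := by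
    intro h
    have h0 : ∀ i j, N i j = 0 := fun i j => by
      have := content_dvd N i j
      rwa [h, zero_dvd_iff] at this
    exact hN (by rw [Matrix.det_fin_two, h0 0 0, h0 0 1]; ring)
  have hmul : N = (content N : ℤ) • red N := by
    ext i j
    simp only [red, Matrix.smul_apply, Matrix.of_apply, smul_eq_mul]
    exact (Int.mul_ediv_cancel' (content_dvd N i j)).symm
  refine ⟨content N, red N, hc, ⟨?_, ?_⟩, hmul⟩
  · have : content N * content (red N) ∣ content N := by
      apply dvd_content
      intro i j
      have h1 : N i j = (content N : ℤ) * red N i j := by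
        conv_lhs => rw [hmul]
        simp
      rw [h1]
      push_cast
      exact mul_dvd_mul_left _ (content_dvd (red N) i j)
    have hpos : 0 < content N := Nat.pos_of_ne_zero (by exact_mod_cast hc)
    have h2 : content N * content (red N) ∣ content N * 1 := by simpa using this
    exact Nat.dvd_one.1 (Nat.dvd_of_mul_dvd_mul_left hpos h2)
  · intro h
    apply hN
    rw [hmul, Matrix.det_smul, h, mul_zero]

/-! ### Commutators of `2 × 2` matrices and admissibility -/

/-- The standard symplectic matrix. -/
def sympl : M2 := !![0, 1; -1, 0]

/-- The commutator of two matrices. -/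
def commut (A B : M2) : M2 := A * B - B * A

/-- The matrix witnessing admissibility of the Fibonacci sequence starting with `A`, `B`. -/
def admMat (A B : M2) : M2 := commut A B * (B * A) * sympl

theorem M2.exists_entries (A : M2) : ∃ a b c d : ℤ, A = !![a, b; c, d] :=
  ⟨_, _, _, _, Matrix.eta_fin_two A⟩

theorem transpose_of_fin_two (a b c d : ℤ) : (!![a, b; c, d] : M2)ᵀ = !![a, c; b, d] := by
  ext i j
  fin_cases i <;> fin_cases j <;> rfl

theorem admMat_mul_sympl_left (A B : M2) :
    A * (admMat A B)ᵀ = (A.det) • (B.adjugate * commut A B * sympl) := by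
  obtain ⟨a, b, c, d, rfl⟩ := M2.exists_entries A
  obtain ⟨p, q, r, s, rfl⟩ := M2.exists_entries B
  ext i j
  fin_cases i <;> fin_cases j <;>
    simp [admMat, commut, sympl, transpose_of_fin_two, Matrix.adjugate_fin_two, Matrix.det_fin_two] <;> ring

theorem admMat_mul_sympl_right (A B : M2) :
    B * admMat A B = (B.det) • (A.adjugate * commut A B * sympl) := by
  obtain ⟨a, b, c, d, rfl⟩ := M2.exists_entries A
  obtain ⟨p, q, r, s, rfl⟩ := M2.exists_entries B
  ext i j
  fin_cases i <;> fin_cases j <;>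
    simp [admMat, commut, sympl, Matrix.adjugate_fin_two, Matrix.det_fin_two] <;> ring

theorem adjugate_mul_commut_isSymm (A B : M2) :
    (A.adjugate * commut A B * sympl).IsSymm ∧ (B.adjugate * commut A B * sympl).IsSymm := by
  obtain ⟨a, b, c, d, rfl⟩ := M2.exists_entries A
  obtain ⟨p, q, r, s, rfl⟩ := M2.exists_entries B
  constructor <;>
  · ext i j
    fin_cases i <;> fin_cases j <;>
      simp [commut, sympl, Matrix.adjugate_fin_two] <;> ring

theorem commut_succ (A B : M2) : commut B (B * A) = -(B * commut A B) := by
  simp only [commut, Matrix.mul_sub, Matrix.mul_assoc, neg_sub]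

theorem admMat_succ (A B : M2) : admMat B (B * A) = (-B.det) • (admMat A B)ᵀ := by
  obtain ⟨a, b, c, d, rfl⟩ := M2.exists_entries A
  obtain ⟨p, q, r, s, rfl⟩ := M2.exists_entries B
  ext i j
  fin_cases i <;> fin_cases j <;>
    simp [admMat, commut, sympl, transpose_of_fin_two, Matrix.det_fin_two] <;> ring

theorem admMat_det (A B : M2) : (admMat A B).det = (commut A B).det * (B.det * A.det) := by
  simp [admMat, Matrix.det_mul, sympl, Matrix.det_fin_two_of]

theorem admMat_offdiag (A B : M2) : admMat A B 0 1 - admMat A B 1 0 = (commut A B).det := by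
  obtain ⟨a, b, c, d, rfl⟩ := M2.exists_entries A
  obtain ⟨p, q, r, s, rfl⟩ := M2.exists_entries B
  simp [admMat, commut, sympl, Matrix.det_fin_two]
  ring

theorem commut_eq_zero_of_det_eq_zero {A B : M2} (hc : A 1 0 ≠ 0)
    (hsq : ∀ m : ℤ, A.trace ^ 2 - 4 * A.det ≠ m ^ 2) (h : (commut A B).det = 0) :
    commut A B = 0 := by
  obtain ⟨a, b, c, d, rfl⟩ := M2.exists_entries A
  obtain ⟨p, q, r, s, rfl⟩ := M2.exists_entries B
  obtain ⟨x, hx⟩ : ∃ x, x = b * r - q * c := ⟨_, rfl⟩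
  obtain ⟨y, hy⟩ : ∃ y, y = a * q + b * s - p * b - q * d := ⟨_, rfl⟩
  obtain ⟨z, hz⟩ : ∃ z, z = c * p + d * r - r * a - s * c := ⟨_, rfl⟩
  have hC : commut !![a, b; c, d] !![p, q; r, s] = !![x, y; z, -x] := by
    ext i j
    fin_cases i <;> fin_cases j <;> simp [commut, hx, hy, hz] <;> ring
  rw [hC] at h ⊢
  simp only [Matrix.det_fin_two_of] at h
  simp only [Matrix.trace_fin_two_of, Matrix.det_fin_two_of] at hsq
  simp only [Matrix.of_apply, Matrix.cons_val_one, Matrix.cons_val_zero] at hc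
  have htr : x * a + y * c + z * b - x * d = 0 := by
    rw [hx, hy, hz]; ring
  have hz0 : z = 0 := by
    by_contra hz0
    have h2 : (2 * c * x + (d - a) * z) ^ 2 = ((a + d) ^ 2 - 4 * (a * d - b * c)) * z ^ 2 := by
      linear_combination (-4 * c * z) * htr - 4 * c ^ 2 * h
    have hdvd : z ∣ 2 * c * x + (d - a) * z := by
      rw [← Int.pow_dvd_pow_iff (n := 2) two_ne_zero, h2]
      exact Dvd.intro_left _ rfl
    obtain ⟨m, hm⟩ := hdvd
    apply hsq m
    have hz2 : z ^ 2 ≠ 0 := pow_ne_zero 2 hz0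
    apply mul_right_cancel₀ hz2
    rw [← h2, hm]
    ring
  have hx0 : x = 0 := by
    rw [hz0] at h
    nlinarith
  have hy0 : y = 0 := by
    rw [hx0, hz0] at htr
    have : y * c = 0 := by linear_combination htr
    exact (mul_eq_zero.1 this).resolve_right hc
  ext i j
  fin_cases i <;> fin_cases j <;> simp [hx0, hy0, hz0]

/-- The value at a symmetric matrix of the linear form with coefficients `a`, `b`, `c`. -/
def linForm (a b c : ℤ) (X : M2) : ℤ := a * X 1 1 + b * X 1 0 + c * X 0 0

theorem eq_zero_of_linForm_eq_zero {A B : M2} (hC : (commut A B).det ≠ 0) {a b c : ℤ}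
    (h1 : linForm a b c (commut A B * sympl) = 0)
    (h2 : linForm a b c (A.adjugate * commut A B * sympl) = 0)
    (h3 : linForm a b c (B.adjugate * commut A B * sympl) = 0) :
    a = 0 ∧ b = 0 ∧ c = 0 := by
  obtain ⟨a₁, b₁, c₁, d₁, rfl⟩ := M2.exists_entries A
  obtain ⟨p, q, r, s, rfl⟩ := M2.exists_entries B
  obtain ⟨x, hx⟩ : ∃ x, x = b₁ * r - q * c₁ := ⟨_, rfl⟩
  obtain ⟨y, hy⟩ : ∃ y, y = a₁ * q + b₁ * s - p * b₁ - q * d₁ := ⟨_, rfl⟩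
  obtain ⟨z, hz⟩ : ∃ z, z = c₁ * p + d₁ * r - r * a₁ - s * c₁ := ⟨_, rfl⟩
  have hCm : commut !![a₁, b₁; c₁, d₁] !![p, q; r, s] = !![x, y; z, -x] := by
    ext i j
    fin_cases i <;> fin_cases j <;> simp [commut, hx, hy, hz] <;> ring
  rw [hCm] at hC h1 h2 h3
  simp only [Matrix.det_fin_two_of] at hC
  simp [linForm, sympl, Matrix.adjugate_fin_two_of] at h1 h2 h3
  let T : Matrix (Fin 3) (Fin 3) ℤ := !![z, x, -y;
    a₁ * z - c₁ * x, c₁ * y + a₁ * x, -(d₁ * y) - b₁ * x;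
    p * z - r * x, r * y + p * x, -(s * y) - q * x]
  have hT : T.det = (x * -x - y * z) ^ 2 := by
    simp only [T, Matrix.det_fin_three]
    simp [hx, hy, hz]
    ring
  have hT0 : T.det ≠ 0 := by
    rw [hT]
    exact pow_ne_zero 2 hC
  have hv := Matrix.eq_zero_of_mulVec_eq_zero (v := ![a, b, c]) hT0 (by
    ext i
    fin_cases i <;> simp [T, Matrix.mulVec, dotProduct, Fin.sum_univ_three]
    · linear_combination h1
    · linear_combination h2
    · linear_combination h3)
  exact ⟨by simpa using congrFun hv 0, by simpa using congrFun hv 1, by simpa using congrFun hv 2⟩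

/-! ### Fibonacci sequences of unimodular matrices -/

section Unimodular

variable {W : ℕ → M2}

theorem commut_det_ne_zero (hG : ∀ i, 1 ≤ i → InGL2Z (W i))
    (hrec : ∀ i, 1 ≤ i → W (i + 2) = W (i + 1) * W i)
    (hC : (commut (W 1) (W 2)).det ≠ 0) :
    ∀ i, 1 ≤ i → (commut (W i) (W (i + 1))).det ≠ 0 := by
  intro i hi
  induction i, hi using Nat.le_induction with
  | base => exact hC
  | succ i hi ih =>
    rw [hrec i hi, commut_succ, Matrix.det_neg, Matrix.det_mul]
    simp only [Fintype.card_fin, even_two, Even.neg_pow, one_pow, one_mul]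
    exact mul_ne_zero (hG (i + 1) (by omega)).memP.2 ih

theorem admMat_eq (hG : ∀ i, 1 ≤ i → InGL2Z (W i))
    (hrec : ∀ i, 1 ≤ i → W (i + 2) = W (i + 1) * W i) :
    ∀ i, 1 ≤ i → ∃ e : ℤ, (e = 1 ∨ e = -1) ∧ admMat (W i) (W (i + 1)) =
      e • (if i % 2 = 1 then admMat (W 1) (W 2) else (admMat (W 1) (W 2))ᵀ) := by
  intro i hi
  induction i, hi using Nat.le_induction with
  | base => exact ⟨1, Or.inl rfl, by simp⟩
  | succ i hi ih =>
    obtain ⟨e, he, h⟩ := ih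
    refine ⟨-(W (i + 1)).det * e, ?_, ?_⟩
    · rcases hG (i + 1) (by omega) with h' | h' <;> rcases he with rfl | rfl <;> rw [h'] <;> norm_num
    · rw [hrec i hi, admMat_succ, h, Matrix.transpose_smul, smul_smul]
      congr 1
      rcases Nat.mod_two_eq_zero_or_one i with h0 | h0
      · have : (i + 1) % 2 = 1 := by omega
        simp [h0, this]
      · have : (i + 1) % 2 = 0 := by omega
        simp [h0, this]

theorem IsSymm.of_smul {k : ℤ} (hk : k ≠ 0) {X : M2} (h : (k • X).IsSymm) : X.IsSymm := by
  unfold Matrix.IsSymm at *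
  rw [Matrix.transpose_smul] at h
  exact smul_right_injective _ hk h

theorem mul_admMat_isSymm (hG : ∀ i, 1 ≤ i → InGL2Z (W i))
    (hrec : ∀ i, 1 ≤ i → W (i + 2) = W (i + 1) * W i) (i : ℕ) (hi : 1 ≤ i) :
    (W i * (if i % 2 = 1 then (admMat (W 1) (W 2))ᵀ else admMat (W 1) (W 2))).IsSymm := by
  obtain ⟨e, he, h⟩ := admMat_eq hG hrec i hi
  have he0 : e ≠ 0 := by rcases he with rfl | rfl <;> norm_num
  apply IsSymm.of_smul he0
  have : e • (W i * (if i % 2 = 1 then (admMat (W 1) (W 2))ᵀ else admMat (W 1) (W 2))) =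
      W i * (admMat (W i) (W (i + 1)))ᵀ := by
    rw [h, Matrix.transpose_smul, Matrix.mul_smul]
    congr 2
    split_ifs <;> simp
  rw [this, admMat_mul_sympl_left]
  exact (adjugate_mul_commut_isSymm _ _).2.smul _

theorem admMat_ne_zero_det (hG : ∀ i, 1 ≤ i → InGL2Z (W i))
    (hC : (commut (W 1) (W 2)).det ≠ 0) : (admMat (W 1) (W 2)).det ≠ 0 := by
  rw [admMat_det]
  exact mul_ne_zero hC (mul_ne_zero (hG 2 (by norm_num)).memP.2 (hG 1 le_rfl).memP.2)

theorem admissibleFib_of_unimodular (hG : ∀ i, 1 ≤ i → InGL2Z (W i))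
    (hrec : ∀ i, 1 ≤ i → W (i + 2) = W (i + 1) * W i)
    (hC : (commut (W 1) (W 2)).det ≠ 0) (htr : (W 2).trace ≠ 0) : AdmissibleFib W := by
  have hdet := admMat_ne_zero_det hG hC
  obtain ⟨k, N, hk, hN, hkN⟩ := exists_primitive_smul hdet
  have hoff := admMat_offdiag (W 1) (W 2)
  refine ⟨N, hN, ?_, ?_, ?_⟩
  · intro h
    apply hC
    rw [← hoff, hkN]
    have h01 : N 0 1 = N 1 0 := by
      conv_lhs => rw [h]
      rfl
    simp [h01]
  · intro h
    have hs := mul_admMat_isSymm hG hrec 2 (by norm_num)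
    simp only [Nat.mod_self, zero_ne_one, if_false] at hs
    rw [hkN, Matrix.mul_smul] at hs
    have hs' := (IsSymm.of_smul hk hs).apply 0 1
    have h00 : N 0 0 = -N 0 0 := congrFun (congrFun h 0) 0
    have h11 : N 1 1 = -N 1 1 := congrFun (congrFun h 1) 1
    have h01 : N 0 1 = -N 1 0 := congrFun (congrFun h 0) 1
    have h00' : N 0 0 = 0 := by omega
    have h11' : N 1 1 = 0 := by omega
    have hd := hN.2
    rw [Matrix.det_fin_two, h00', h01] at hd
    simp only [Matrix.mul_apply, Fin.sum_univ_two, h00', h11', h01] at hs'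
    have h3 : (W 2).trace * N 1 0 = 0 := by
      rw [Matrix.trace_fin_two]; linear_combination hs'
    rcases mul_eq_zero.1 h3 with h4 | h4
    · exact htr h4
    · rw [h4] at hd; simp at hd
  · intro i hi
    have hs := mul_admMat_isSymm hG hrec i hi
    apply IsSymm.of_smul hk
    rw [hkN] at hs
    convert hs using 1
    rw [← Matrix.mul_smul]
    congr 1
    split_ifs
    · exact (Matrix.transpose_smul k N).symm
    · rfl

end Unimodular

/-! ### Norm estimates -/

theorem abs_entry_le_mnorm (A : M2) (i j : Fin 2) : |(A i j : ℝ)| ≤ mnorm A := by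
  unfold mnorm
  fin_cases i <;> fin_cases j <;> simp

theorem mnorm_le {A : M2} {C : ℝ} (h : ∀ i j, |(A i j : ℝ)| ≤ C) : mnorm A ≤ C :=
  max_le (max_le (h _ _) (h _ _)) (max_le (h _ _) (h _ _))

theorem mnorm_nonneg (A : M2) : 0 ≤ mnorm A := (abs_nonneg _).trans (abs_entry_le_mnorm A 0 0)

theorem one_le_mnorm {A : M2} (h : A.det ≠ 0) : 1 ≤ mnorm A := by
  by_contra hlt
  push Not at hlt
  have h0 : ∀ i j, A i j = 0 := fun i j => by
    have := (abs_entry_le_mnorm A i j).trans_lt hlt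
    rw [← Int.cast_abs] at this
    exact Int.abs_lt_one_iff.1 (by exact_mod_cast this)
  exact h (by rw [Matrix.det_fin_two, h0 0 0, h0 0 1]; ring)

theorem abs_mul_add_mul_le {a b c d s t : ℝ} (ha : |a| ≤ s) (hb : |b| ≤ t) (hc : |c| ≤ s)
    (hd : |d| ≤ t) : |a * b + c * d| ≤ 2 * s * t := by
  have h1 : |a * b| ≤ s * t := by
    rw [abs_mul]; exact mul_le_mul ha hb (abs_nonneg _) ((abs_nonneg _).trans ha)
  have h2 : |c * d| ≤ s * t := by
    rw [abs_mul]; exact mul_le_mul hc hd (abs_nonneg _) ((abs_nonneg _).trans hc)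
  have := abs_add_le (a * b) (c * d)
  linarith

theorem mnorm_mul_le (A B : M2) : mnorm (A * B) ≤ 2 * mnorm A * mnorm B := by
  apply mnorm_le
  intro i j
  rw [Matrix.mul_apply, Fin.sum_univ_two]
  push_cast
  exact abs_mul_add_mul_le (abs_entry_le_mnorm _ _ _) (abs_entry_le_mnorm _ _ _)
    (abs_entry_le_mnorm _ _ _) (abs_entry_le_mnorm _ _ _)

theorem mnorm_transpose (A : M2) : mnorm Aᵀ = mnorm A := by
  simp only [mnorm, Matrix.transpose_apply]
  rw [max_max_max_comm]

theorem mnorm_neg (A : M2) : mnorm (-A) = mnorm A := by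
  simp [mnorm]

theorem mnorm_adjugate_le (A : M2) : mnorm A.adjugate ≤ mnorm A := by
  apply mnorm_le
  intro i j
  rw [Matrix.adjugate_fin_two]
  fin_cases i <;> fin_cases j <;> simpa using abs_entry_le_mnorm A _ _

theorem xiNorm_nonneg (ξ : ℝ) (A : M2) : 0 ≤ xiNorm ξ A := (abs_nonneg _).trans (le_max_left _ _)

theorem xiNorm_mul_le (ξ : ℝ) (A B : M2) : xiNorm ξ (A * B) ≤ 2 * xiNorm ξ A * mnorm B := by
  have key : ∀ j, |ξ * ((A * B) 0 j : ℝ) - ((A * B) 1 j : ℝ)| ≤ 2 * xiNorm ξ A * mnorm B := by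
    intro j
    have : ξ * ((A * B) 0 j : ℝ) - ((A * B) 1 j : ℝ) =
        (ξ * (A 0 0 : ℝ) - (A 1 0 : ℝ)) * (B 0 j : ℝ) +
          (ξ * (A 0 1 : ℝ) - (A 1 1 : ℝ)) * (B 1 j : ℝ) := by
      simp only [Matrix.mul_apply, Fin.sum_univ_two]
      push_cast
      ring
    rw [this]
    exact abs_mul_add_mul_le (le_max_left _ _) (abs_entry_le_mnorm _ _ _) (le_max_right _ _)
      (abs_entry_le_mnorm _ _ _)
  exact max_le (key 0) (key 1)

/-! ### Extremality -/

theorem linForm_smul (a b c k : ℤ) (X : M2) : linForm a b c (k • X) = k * linForm a b c X := by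
  simp only [linForm, Matrix.smul_apply, smul_eq_mul]
  ring

theorem abs_linForm_le {ξ : ℝ} {a b c : ℤ} (h : a * ξ ^ 2 + b * ξ + c = 0) {X : M2}
    (hX : X.IsSymm) : |(linForm a b c X : ℝ)| ≤ (|(a : ℝ)| + |a * ξ + b|) * xiNorm ξ X := by
  have h10 : X 0 1 = X 1 0 := hX.apply 1 0
  have : (linForm a b c X : ℝ) = (-a) * (ξ * X 0 1 - X 1 1) + (-(a * ξ + b)) * (ξ * X 0 0 - X 1 0) := by
    simp only [linForm]
    rw [h10]
    push_cast
    linear_combination (X 0 0 : ℝ) * h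
  rw [this]
  refine (abs_add_le _ _).trans ?_
  rw [abs_mul, abs_mul, abs_neg, abs_neg, add_mul]
  exact add_le_add (mul_le_mul_of_nonneg_left (le_max_right _ _) (abs_nonneg _))
    (mul_le_mul_of_nonneg_left (le_max_left _ _) (abs_nonneg _))

theorem commut_mul_sympl_isSymm (A B : M2) : (commut A B * sympl).IsSymm := by
  obtain ⟨a, b, c, d, rfl⟩ := M2.exists_entries A
  obtain ⟨p, q, r, s, rfl⟩ := M2.exists_entries B
  ext i j
  fin_cases i <;> fin_cases j <;> simp [commut, sympl] <;> ring

theorem mul_mul_admMat_transpose (A B : M2) :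
    B * A * (admMat A B)ᵀ = (B.det * A.det) • (commut A B * sympl) := by
  rw [Matrix.mul_assoc, admMat_mul_sympl_left, Matrix.mul_smul, ← Matrix.mul_assoc,
    ← Matrix.mul_assoc, Matrix.mul_adjugate, Matrix.smul_mul, Matrix.smul_mul, Matrix.one_mul,
    smul_smul, mul_comm]

theorem mnorm_admMat {W : ℕ → M2} (hG : ∀ i, 1 ≤ i → InGL2Z (W i))
    (hrec : ∀ i, 1 ≤ i → W (i + 2) = W (i + 1) * W i) (i : ℕ) (hi : 1 ≤ i) :
    mnorm (admMat (W i) (W (i + 1))) = mnorm (admMat (W 1) (W 2)) := by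
  obtain ⟨e, he, h⟩ := admMat_eq hG hrec i hi
  have h' : mnorm (if i % 2 = 1 then admMat (W 1) (W 2) else (admMat (W 1) (W 2))ᵀ) =
      mnorm (admMat (W 1) (W 2)) := by
    split_ifs
    · rfl
    · exact mnorm_transpose _
  rcases he with rfl | rfl
  · rw [h, one_smul, h']
  · rw [h, neg_smul, one_smul, mnorm_neg, h']

open Filter Topology in
theorem int_not_quadratic {ξ : ℝ} {W : ℕ → M2} (hG : ∀ i, 1 ≤ i → InGL2Z (W i))
    (hrec : ∀ i, 1 ≤ i → W (i + 2) = W (i + 1) * W i)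
    (hC : (commut (W 1) (W 2)).det ≠ 0)
    (hlim : Tendsto (fun i => xiNorm ξ (W i)) atTop (𝓝 0)) {a b c : ℤ}
    (h : a * ξ ^ 2 + b * ξ + c = 0) : a = 0 ∧ b = 0 ∧ c = 0 := by
  obtain ⟨K, hK⟩ : ∃ K, K = (|(a : ℝ)| + |a * ξ + b|) * (2 * mnorm (admMat (W 1) (W 2))) := ⟨_, rfl⟩
  have hlimK : Tendsto (fun i => K * xiNorm ξ (W i)) atTop (𝓝 0) := by
    simpa using hlim.const_mul K
  obtain ⟨i, hi1, hi⟩ : ∃ i, 1 ≤ i ∧ ∀ j, i ≤ j → K * xiNorm ξ (W j) < 1 := by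
    obtain ⟨i, hi⟩ := eventually_atTop.1 (hlimK.eventually (gt_mem_nhds zero_lt_one))
    exact ⟨i + 1, by omega, fun j hj => hi j (by omega)⟩
  have key : ∀ j, i ≤ j → ∀ P : M2, mnorm P = mnorm (admMat (W 1) (W 2)) → (W j * P).IsSymm →
      linForm a b c (W j * P) = 0 := by
    intro j hj P hP hs
    have h1 : |(linForm a b c (W j * P) : ℝ)| < 1 := by
      refine (abs_linForm_le h hs).trans_lt (lt_of_le_of_lt ?_ (hi j hj))
      rw [hK, mul_assoc]
      refine mul_le_mul_of_nonneg_left ?_ (by positivity)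
      have := xiNorm_mul_le ξ (W j) P
      rw [hP] at this
      linarith
    rw [← Int.cast_abs] at h1
    exact Int.abs_lt_one_iff.1 (by exact_mod_cast h1)
  have hN := mnorm_admMat hG hrec i hi1
  have hd1 := (hG i hi1).memP.2
  have hd2 := (hG (i + 1) (by omega)).memP.2
  have hsym := adjugate_mul_commut_isSymm (W i) (W (i + 1))
  have e1 := key i le_rfl (admMat (W i) (W (i + 1)))ᵀ ((mnorm_transpose _).trans hN) (by
    rw [admMat_mul_sympl_left]; exact hsym.2.smul _)
  have e2 := key (i + 1) (by omega) (admMat (W i) (W (i + 1))) hN (by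
    rw [admMat_mul_sympl_right]; exact hsym.1.smul _)
  have e3 := key (i + 2) (by omega) (admMat (W i) (W (i + 1)))ᵀ ((mnorm_transpose _).trans hN) (by
    rw [hrec i hi1, mul_mul_admMat_transpose]; exact (commut_mul_sympl_isSymm _ _).smul _)
  rw [admMat_mul_sympl_left, linForm_smul] at e1
  rw [admMat_mul_sympl_right, linForm_smul] at e2
  rw [hrec i hi1, mul_mul_admMat_transpose, linForm_smul] at e3
  exact eq_zero_of_linForm_eq_zero (commut_det_ne_zero hG hrec hC i hi1)
    ((mul_eq_zero.1 e3).resolve_left (mul_ne_zero hd2 hd1))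
    ((mul_eq_zero.1 e2).resolve_left hd2) ((mul_eq_zero.1 e1).resolve_left hd1)

theorem rat_of_int_not_quadratic {ξ : ℝ}
    (H : ∀ a b c : ℤ, a * ξ ^ 2 + b * ξ + c = 0 → a = 0 ∧ b = 0 ∧ c = 0) (a b c : ℚ)
    (h0 : ¬(a = 0 ∧ b = 0 ∧ c = 0)) : (a : ℝ) * ξ ^ 2 + (b : ℝ) * ξ + (c : ℝ) ≠ 0 := by
  intro h
  apply h0
  have key : ∀ (q : ℚ), (q.den : ℝ) * q = q.num := fun q => by
    have := Rat.mul_den_eq_num q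
    rw [mul_comm] at this
    exact_mod_cast this
  have hden : ∀ (q : ℚ), (q.den : ℤ) ≠ 0 := fun q => by exact_mod_cast q.den_nz
  obtain ⟨ha, hb, hc⟩ := H (a.num * b.den * c.den) (b.num * a.den * c.den)
    (c.num * a.den * b.den) (by
      push_cast
      rw [← key a, ← key b, ← key c]
      linear_combination ((a.den : ℝ) * b.den * c.den) * h)
  simpa [hden, Rat.den_nz] using And.intro ha (And.intro hb hc)

theorem gam_pos : 0 < gam := by unfold gam; positivity

theorem gam_sq : gam ^ 2 = gam + 1 := by
  have h5 : Real.sqrt 5 ^ 2 = 5 := Real.sq_sqrt (by norm_num)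
  unfold gam
  linear_combination h5 / 4

theorem one_lt_gam : 1 < gam := by
  nlinarith [gam_sq, gam_pos]

theorem gam_lt_two : gam < 2 := by
  nlinarith [gam_sq, gam_pos]

theorem exists_extremal_points {ξ : ℝ} {W : ℕ → M2} {N : M2}
    (hG : ∀ i, 1 ≤ i → InGL2Z (W i)) (hN : N.det ≠ 0)
    (hS : ∀ i, 1 ≤ i → (W i * (if i % 2 = 1 then Nᵀ else N)).IsSymm) (hub : UnboundedSeq W)
    {c₂ c₄ : ℝ} (hc₂ : 0 < c₂) (hc₄ : 0 < c₄)
    (h₂ : ∀ i, 1 ≤ i → mnorm (W (i + 1)) ≤ c₂ * mnorm (W i) ^ gam)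
    (h₄ : ∀ i, 1 ≤ i → xiNorm ξ (W i) ≤ c₄ * (mnorm (W i))⁻¹) :
    ∃ c : ℝ, 0 < c ∧ ∀ X : ℝ, 1 ≤ X → ∃ x₀ x₁ x₂ : ℤ,
      ¬(x₀ = 0 ∧ x₁ = 0 ∧ x₂ = 0) ∧ |(x₀ : ℝ)| ≤ X ∧
      |(x₀ : ℝ) * ξ - (x₁ : ℝ)| ≤ c * X ^ (-1 / gam) ∧
      |(x₀ : ℝ) * ξ ^ 2 - (x₂ : ℝ)| ≤ c * X ^ (-1 / gam) := by
  obtain ⟨K, hK⟩ : ∃ K, K = 2 * mnorm N := ⟨_, rfl⟩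
  have hKpos : 0 < K := by have := one_le_mnorm hN; linarith
  have hW1 : ∀ i, 1 ≤ i → 1 ≤ mnorm (W i) := fun i hi => one_le_mnorm (hG i hi).memP.2
  have hγ := gam_pos
  have hm1 := hW1 1 le_rfl
  obtain ⟨d₁, hd₁⟩ : ∃ d, d = (K * mnorm (W 1)) ^ (1 / gam) := ⟨_, rfl⟩
  obtain ⟨d₂, hd₂⟩ : ∃ d, d = (|ξ| + 1) * (K * c₄) * (K * c₂) ^ (1 / gam) := ⟨_, rfl⟩
  have hd₁pos : 0 < d₁ := by rw [hd₁]; positivity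
  have hd₂pos : 0 < d₂ := by rw [hd₂]; positivity
  refine ⟨d₁ + d₂, by positivity, ?_⟩
  intro X hX
  have hXpos : 0 < X := by linarith
  have hXneg : X ^ (-1 / gam) = (X ^ (1 / gam))⁻¹ := by
    rw [neg_div, Real.rpow_neg hXpos.le]
  have hXr : 0 < X ^ (1 / gam) := Real.rpow_pos_of_pos hXpos _
  have hex : ∃ i, 1 ≤ i ∧ X < K * mnorm (W i) := by
    obtain ⟨i, hi, h⟩ := hub (X / K)
    exact ⟨i, hi, by rwa [div_lt_iff₀' hKpos] at h⟩
  classical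
  obtain ⟨hm, hXm⟩ := Nat.find_spec hex
  have hmin : ∀ j, j < Nat.find hex → ¬(1 ≤ j ∧ X < K * mnorm (W j)) := fun j hj => Nat.find_min hex hj
  generalize Nat.find hex = m at hm hXm hmin
  obtain rfl | hm2 := hm.eq_or_lt
  · refine ⟨0, 0, 1, by simp, by simpa using hXpos.le, ?_, ?_⟩
    · simp only [Int.cast_zero, zero_mul, sub_zero, abs_zero]; positivity
    · simp only [Int.cast_zero, Int.cast_one, zero_mul, zero_sub, abs_neg, abs_one]
      rw [hXneg, ← div_eq_mul_inv, one_le_div hXr]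
      have : X ^ (1 / gam) ≤ d₁ := by
        rw [hd₁]; exact Real.rpow_le_rpow hXpos.le hXm.le (by positivity)
      linarith
  · obtain ⟨j, rfl⟩ : ∃ j, m = j + 1 := ⟨m - 1, by omega⟩
    have hj : 1 ≤ j := by omega
    have hXj : K * mnorm (W j) ≤ X := by
      by_contra h
      exact hmin j (by omega) ⟨hj, by push Not at h; exact h⟩
    have hmj := hW1 j hj
    obtain ⟨P, hP⟩ : ∃ P, P = (if j % 2 = 1 then Nᵀ else N) := ⟨_, rfl⟩
    have hPn : mnorm P = mnorm N := by
      rw [hP]; split_ifs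
      · exact mnorm_transpose _
      · rfl
    have hPd : P.det ≠ 0 := by
      rw [hP]; split_ifs
      · rwa [Matrix.det_transpose]
      · exact hN
    have hs := hS j hj
    rw [← hP] at hs
    obtain ⟨S, hSd⟩ : ∃ S, S = W j * P := ⟨_, rfl⟩
    have hSdet : S.det ≠ 0 := by
      rw [hSd, Matrix.det_mul]; exact mul_ne_zero (hG j hj).memP.2 hPd
    rw [← hSd] at hs
    have hs01 : S 0 1 = S 1 0 := hs.apply 1 0
    have herr : xiNorm ξ S ≤ K * c₄ * (mnorm (W j))⁻¹ := by
      rw [hSd]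
      refine (xiNorm_mul_le _ _ _).trans ?_
      rw [hPn, hK]
      have := mul_le_mul_of_nonneg_left (h₄ j hj) (mnorm_nonneg N)
      linarith
    have hinv : (mnorm (W j))⁻¹ ≤ (K * c₂) ^ (1 / gam) * X ^ (-1 / gam) := by
      rw [hXneg, ← div_eq_mul_inv, inv_le_comm₀ (by linarith) (by positivity), inv_div,
        div_le_iff₀ (by positivity)]
      have h1 : X ≤ K * c₂ * mnorm (W j) ^ gam := by
        have := mul_le_mul_of_nonneg_left (h₂ j hj) hKpos.le
        linarith
      calc X ^ (1 / gam) ≤ (K * c₂ * mnorm (W j) ^ gam) ^ (1 / gam) :=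
            Real.rpow_le_rpow hXpos.le h1 (by positivity)
        _ = mnorm (W j) * (K * c₂) ^ (1 / gam) := by
            rw [Real.mul_rpow (by positivity) (by positivity), ← Real.rpow_mul (by linarith),
              mul_one_div_cancel hγ.ne', Real.rpow_one, mul_comm]
    have hbound : (|ξ| + 1) * xiNorm ξ S ≤ (d₁ + d₂) * X ^ (-1 / gam) := by
      have hp : 0 ≤ X ^ (-1 / gam) := by rw [hXneg]; positivity
      calc (|ξ| + 1) * xiNorm ξ S
          ≤ (|ξ| + 1) * (K * c₄ * ((K * c₂) ^ (1 / gam) * X ^ (-1 / gam))) := by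
            refine mul_le_mul_of_nonneg_left (herr.trans ?_) (by positivity)
            exact mul_le_mul_of_nonneg_left hinv (by positivity)
        _ = d₂ * X ^ (-1 / gam) := by rw [hd₂]; ring
        _ ≤ _ := mul_le_mul_of_nonneg_right (by linarith) hp
    have hx0 := xiNorm_nonneg ξ S
    have e0 : |ξ * (S 0 0 : ℝ) - (S 1 0 : ℝ)| ≤ xiNorm ξ S := le_max_left _ _
    have e1 : |ξ * (S 0 1 : ℝ) - (S 1 1 : ℝ)| ≤ xiNorm ξ S := le_max_right _ _
    refine ⟨S 0 0, S 1 0, S 1 1, ?_, ?_, ?_, ?_⟩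
    · rintro ⟨a, b, c⟩
      apply hSdet
      rw [Matrix.det_fin_two, a, b]; ring
    · refine (abs_entry_le_mnorm S 0 0).trans (le_trans ?_ hXj)
      rw [hSd]
      refine (mnorm_mul_le _ _).trans (le_of_eq ?_)
      rw [hPn, hK]; ring
    · rw [mul_comm]
      refine e0.trans (le_trans ?_ hbound)
      nlinarith [mul_nonneg (abs_nonneg ξ) hx0]
    · refine le_trans ?_ hbound
      have : (S 0 0 : ℝ) * ξ ^ 2 - S 1 1 = ξ * (ξ * (S 0 0 : ℝ) - (S 1 0 : ℝ)) +
          (ξ * (S 0 1 : ℝ) - (S 1 1 : ℝ)) := by rw [hs01]; ring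
      rw [this]
      refine (abs_add_le _ _).trans ?_
      rw [abs_mul, add_mul, one_mul]
      exact add_le_add (mul_le_mul_of_nonneg_left e0 (abs_nonneg _)) e1

/-! ### Matrices attached to words -/

/-- The product of the matrices `(a 1; 1 0)` over the letters `a` of a word. -/
def wordMat : List ℕ+ → M2
  | [] => 1
  | a :: u => !![((a : ℕ) : ℤ), 1; 1, 0] * wordMat u

theorem wordMat_append (u v : List ℕ+) : wordMat (u ++ v) = wordMat u * wordMat v := by
  induction u with
  | nil => simp [wordMat]
  | cons a u ih => simp only [List.cons_append, wordMat, ih, Matrix.mul_assoc]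

theorem wordMat_inGL2Z (u : List ℕ+) : InGL2Z (wordMat u) := by
  induction u with
  | nil => exact Or.inl (by simp [wordMat])
  | cons a u ih => exact InGL2Z.mul (Or.inr (by simp [Matrix.det_fin_two])) ih

theorem wordMat_cons_entries (a : ℕ+) (u : List ℕ+) :
    wordMat (a :: u) 0 0 = (a : ℕ) * wordMat u 0 0 + wordMat u 1 0 ∧
    wordMat (a :: u) 0 1 = (a : ℕ) * wordMat u 0 1 + wordMat u 1 1 ∧
    wordMat (a :: u) 1 0 = wordMat u 0 0 ∧ wordMat (a :: u) 1 1 = wordMat u 0 1 := by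
  refine ⟨?_, ?_, ?_, ?_⟩ <;> simp [wordMat, Matrix.mul_apply, Fin.sum_univ_two]

/-- Matrices of nonempty words have decreasing nonnegative coefficients. -/
structure Dominant (A : M2) : Prop where
  nonneg : 0 ≤ A 1 1
  le01 : A 1 1 ≤ A 0 1
  le10 : A 1 1 ≤ A 1 0
  le00 : A 0 1 ≤ A 0 0
  le00' : A 1 0 ≤ A 0 0
  pos01 : 1 ≤ A 0 1
  pos10 : 1 ≤ A 1 0

theorem PNat.one_le_cast_int (a : ℕ+) : (1 : ℤ) ≤ ((a : ℕ) : ℤ) := by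
  exact_mod_cast (one_le : 1 ≤ (a : ℕ+))

theorem wordMat_dominant {u : List ℕ+} (hu : u ≠ []) : Dominant (wordMat u) := by
  induction u with
  | nil => exact absurd rfl hu
  | cons a u ih =>
    obtain ⟨h1, h2, h3, h4⟩ := wordMat_cons_entries a u
    have ha := PNat.one_le_cast_int a
    rcases eq_or_ne u [] with rfl | hne
    · simp only [wordMat, Matrix.one_apply_eq, ne_eq, zero_ne_one, one_ne_zero,
        not_false_eq_true, Matrix.one_apply_ne, mul_one, mul_zero, add_zero, zero_add] at h1 h2 h3 h4
      constructor <;> simp only [wordMat, mul_one, h1, h2, h3, h4] <;> simp [ha]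
    · obtain ⟨g1, g2, g3, g4, g5, g6, g7⟩ := ih hne
      constructor <;> simp only [h1, h2, h3, h4] <;> nlinarith

theorem wordMat_weak (u : List ℕ+) :
    1 ≤ wordMat u 0 0 ∧ 0 ≤ wordMat u 1 0 ∧ wordMat u 1 0 ≤ wordMat u 0 0 ∧
      0 ≤ wordMat u 0 1 ∧ 0 ≤ wordMat u 1 1 := by
  rcases eq_or_ne u [] with rfl | hne
  · simp [wordMat]
  · obtain ⟨g1, g2, g3, g4, g5, g6, g7⟩ := wordMat_dominant hne
    refine ⟨?_, ?_, ?_, ?_, ?_⟩ <;> linarith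

theorem wordMat_cons_head_le {a b : ℕ+} {u v : List ℕ+}
    (h : wordMat (a :: u) = wordMat (b :: v)) : a ≤ b := by
  by_contra hlt
  push Not at hlt
  have hab : ((b : ℕ) : ℤ) + 1 ≤ ((a : ℕ) : ℤ) := by exact_mod_cast hlt
  obtain ⟨h1, h2, h3, h4⟩ := wordMat_cons_entries a u
  obtain ⟨k1, k2, k3, k4⟩ := wordMat_cons_entries b v
  rw [h] at h1 h2 h3 h4
  rw [k1] at h1; rw [k2] at h2; rw [k3] at h3; rw [k4] at h4
  rw [h3] at h1; rw [h4] at h2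
  obtain ⟨a1, a2, a3, a4, a5⟩ := wordMat_weak u
  obtain ⟨b1, b2, b3, b4, b5⟩ := wordMat_weak v
  have hq : wordMat u 1 0 = 0 := by nlinarith
  have hu : u = [] := by
    by_contra hne
    have := (wordMat_dominant hne).pos10
    omega
  have hv : v ≠ [] := by
    rintro rfl
    have : wordMat ([] : List ℕ+) 1 0 = 0 := by simp [wordMat]
    nlinarith
  have hd := wordMat_dominant hv
  have h5 := hd.pos01
  subst hu
  have : wordMat ([] : List ℕ+) 0 1 = 0 := by simp [wordMat]
  omega

theorem wordMat_injective : Function.Injective wordMat := by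
  intro u
  induction u with
  | nil =>
    intro v h
    by_contra hne
    have := (wordMat_dominant (Ne.symm hne)).pos10
    rw [← h] at this
    simp [wordMat] at this
  | cons a u ih =>
    intro v h
    cases v with
    | nil =>
      have := (wordMat_dominant (List.cons_ne_nil a u)).pos10
      rw [h] at this
      simp [wordMat] at this
    | cons b v =>
      have hab : a = b := le_antisymm (wordMat_cons_head_le h) (wordMat_cons_head_le h.symm)
      subst hab
      congr 1
      apply ih
      obtain ⟨h1, h2, h3, h4⟩ := wordMat_cons_entries a u
      obtain ⟨k1, k2, k3, k4⟩ := wordMat_cons_entries a v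
      rw [h] at h1 h2 h3 h4
      rw [k1] at h1; rw [k2] at h2; rw [k3] at h3; rw [k4] at h4
      rw [h3] at h1; rw [h4] at h2
      ext i j
      fin_cases i <;> fin_cases j <;> simp <;> omega

/-- Unimodular matrices with decreasing nonnegative coefficients come from words. -/
theorem exists_wordMat_eq {A : M2} (hA : InGL2Z A) (h11 : 0 ≤ A 1 1) (h01 : A 1 1 ≤ A 0 1)
    (h10 : A 1 1 ≤ A 1 0) (h00 : A 0 1 ≤ A 0 0) (h00' : A 1 0 ≤ A 0 0) :
    ∃ u, wordMat u = A := by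
  obtain ⟨n, hn⟩ : ∃ n : ℕ, A 1 0 ≤ n := ⟨(A 1 0).toNat, Int.self_le_toNat _⟩
  induction n generalizing A with
  | zero =>
    exfalso
    have e1 : A 1 1 = 0 := by push_cast at hn; omega
    have e2 : A 1 0 = 0 := by push_cast at hn; omega
    exact hA.memP.2 (by rw [Matrix.det_fin_two, e1, e2]; ring)
  | succ n ih =>
    obtain ⟨a, b, c, d, rfl⟩ := M2.exists_entries A
    simp at h11 h01 h10 h00 h00' hn
    simp only [InGL2Z, Matrix.det_fin_two_of] at hA
    have hc : 1 ≤ c := by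
      by_contra hc
      have : c = 0 := by omega
      have : d = 0 := by omega
      subst_vars
      simp at hA
    have hb : 1 ≤ b := by
      by_contra hc
      have : b = 0 := by omega
      have : d = 0 := by omega
      subst_vars
      simp at hA
    rcases h11.eq_or_lt with hd | hd
    · subst hd
      have hbc : b * c = 1 := by
        have : 0 < b * c := by positivity
        rcases hA with h | h <;> linarith
      have hb1 : b = 1 := Int.eq_one_of_mul_eq_one_right (by omega) hbc
      have hc1 : c = 1 := by rw [hb1] at hbc; omega
      subst hb1; subst hc1
      obtain ⟨a', rfl⟩ : ∃ a' : ℕ+, ((a' : ℕ) : ℤ) = a :=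
        ⟨a.toNat.toPNat (by omega), by simp [Nat.toPNat]; omega⟩
      exact ⟨[a'], by simp [wordMat]⟩
    · have hr0 := Int.emod_nonneg a (show c ≠ 0 by omega)
      have hr1 := Int.emod_lt_of_pos a (show 0 < c by omega)
      have hdiv := Int.mul_ediv_add_emod a c
      have hk : 1 ≤ a / c := by
        rw [Int.le_ediv_iff_mul_le (by omega)]; omega
      generalize a % c = r at hr0 hr1 hdiv
      generalize a / c = k at hk hdiv
      obtain ⟨k', rfl⟩ : ∃ k' : ℕ+, ((k' : ℕ) : ℤ) = k :=
        ⟨k.toNat.toPNat (by omega), by simp [Nat.toPNat]; omega⟩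
      rcases hr0.eq_or_lt with hr | hr
      · subst hr
        rw [add_zero] at hdiv
        have hc1 : c = 1 := by
          have : c ∣ 1 := by
            have h' : c ∣ a * d - b * c :=
              dvd_sub ((Dvd.intro _ hdiv).mul_right d) (dvd_mul_left c b)
            rcases hA with h | h <;> rw [h] at h'
            · exact h'
            · exact (dvd_neg.2 h').trans (by norm_num)
          exact Int.eq_one_of_dvd_one (by omega) this
        subst hc1
        have hd1 : d = 1 := by omega
        subst hd1
        obtain ⟨b', rfl⟩ : ∃ b' : ℕ+, ((b' : ℕ) : ℤ) = b :=
          ⟨b.toNat.toPNat (by omega), by simp [Nat.toPNat]; omega⟩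
        refine ⟨[b', 1], ?_⟩
        ext i j
        fin_cases i <;> fin_cases j <;> simp [wordMat]
        omega
      · obtain ⟨s, hs⟩ : ∃ s, s = b - (k' : ℕ) * d := ⟨_, rfl⟩
        have hdet : c * s - d * r = 1 ∨ c * s - d * r = -1 := by
          have : c * s - d * r = -(a * d - b * c) := by rw [hs, ← hdiv]; ring
          rw [this]; omega
        have hs0 : 0 ≤ s := by
          by_contra hlt
          have : c * s ≤ -c := by nlinarith
          have : 1 ≤ d * r := by nlinarith
          rcases hdet with h | h <;> nlinarith
        have hsd : s ≤ d := by
          by_contra hlt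
          push Not at hlt
          have : c * (d + 1) ≤ c * s := by nlinarith
          have : d * r ≤ d * (c - 1) := by nlinarith
          rcases hdet with h | h <;> nlinarith
        have hsr : s ≤ r := by
          by_contra hlt
          push Not at hlt
          have : c * (r + 1) ≤ c * s := by nlinarith
          have : d * r ≤ c * r := by nlinarith
          rcases hdet with h | h <;> nlinarith
        obtain ⟨u, hu⟩ := ih (A := !![c, d; r, s]) (by
          simp only [InGL2Z, Matrix.det_fin_two_of]; exact hdet) (by simpa using hs0)
          (by simpa using hsd) (by simpa using hsr) (by simpa using h10) (by simpa using hr1.le)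
          (by simp; omega)
        refine ⟨k' :: u, ?_⟩
        rw [wordMat, hu]
        ext i j
        fin_cases i <;> fin_cases j <;> simp
        · linarith
        · linarith

/-! ### Complete quotients of continued fractions -/

/-- The complete quotients of the continued fraction expansion of a real number. -/
noncomputable def cq : ℕ → ℝ → ℝ
  | 0, ξ => ξ
  | n + 1, ξ => cq n (ξ - ⌊ξ⌋)⁻¹

theorem cfA_add (m n : ℕ) (ξ : ℝ) : cfA (m + n) ξ = cfA n (cq m ξ) := by
  induction m generalizing ξ with
  | zero => simp [cq]
  | succ m ih => rw [Nat.add_right_comm, cfA, ih, cq]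

theorem cfA_eq_floor_cq (n : ℕ) (ξ : ℝ) : cfA n ξ = ⌊cq n ξ⌋ := cfA_add n 0 ξ

theorem cq_succ' (n : ℕ) (ξ : ℝ) : cq (n + 1) ξ = (cq n ξ - ⌊cq n ξ⌋)⁻¹ := by
  induction n generalizing ξ with
  | zero => rfl
  | succ n ih => rw [cq, ih, cq]

theorem Irrational.cq {ξ : ℝ} (h : Irrational ξ) (n : ℕ) : Irrational (cq n ξ) := by
  induction n generalizing ξ with
  | zero => exact h
  | succ n ih => exact ih (h.sub_intCast _).inv

theorem Irrational.floor_lt {ξ : ℝ} (h : Irrational ξ) : (⌊ξ⌋ : ℝ) < ξ :=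
  (Int.floor_le ξ).lt_of_ne (h.ne_int _).symm

theorem Irrational.one_lt_inv_fract {ξ : ℝ} (h : Irrational ξ) : 1 < (ξ - ⌊ξ⌋)⁻¹ :=
  (one_lt_inv₀ (sub_pos.2 h.floor_lt)).2 (by linarith [Int.lt_floor_add_one ξ])

theorem Irrational.one_lt_cq {ξ : ℝ} (h : Irrational ξ) {n : ℕ} (hn : 1 ≤ n) :
    1 < _root_.cq n ξ := by
  obtain ⟨m, rfl⟩ : ∃ m, n = m + 1 := ⟨n - 1, by omega⟩
  rw [cq_succ']
  exact (h.cq m).one_lt_inv_fract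

theorem Irrational.one_le_cfA {ξ : ℝ} (h : Irrational ξ) {n : ℕ} (hn : 1 ≤ n) :
    1 ≤ cfA n ξ := by
  rw [cfA_eq_floor_cq, Int.le_floor]
  exact_mod_cast (h.one_lt_cq hn).le

/-- The row vector `(x, y)` is sent by `g` to `r (1, -θ)`. -/
structure Turns (x y : ℝ) (g : M2) (r θ : ℝ) : Prop where
  fst : x * g 0 0 + y * g 1 0 = r
  snd : x * g 0 1 + y * g 1 1 = -(r * θ)

theorem Turns.mul {x y r s θ τ : ℝ} {g h : M2} (hg : Turns x y g r θ) (hh : Turns 1 (-θ) h s τ) :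
    Turns x y (g * h) (r * s) τ := by
  constructor <;> simp only [Matrix.mul_apply, Fin.sum_univ_two] <;> push_cast
  · linear_combination (h 0 0 : ℝ) * hg.fst + (h 1 0 : ℝ) * hg.snd + r * hh.fst
  · linear_combination (h 0 1 : ℝ) * hg.fst + (h 1 1 : ℝ) * hg.snd + r * hh.snd

theorem turns_letter {θ : ℝ} {a : ℤ} (h : θ - a ≠ 0) :
    Turns 1 (-θ) !![a, 1; 1, 0] (a - θ) (θ - a)⁻¹ := by
  constructor
  · simp; ring
  · have : (a - θ) * (θ - a)⁻¹ = -1 := by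
      rw [← neg_sub θ, neg_mul, mul_inv_cancel₀ h]
    rw [this]; simp

theorem turns_letter_inv {θ : ℝ} (a : ℤ) (h : θ ≠ 0) :
    Turns 1 (-θ) !![0, 1; 1, -a] (-θ) (a + θ⁻¹) := by
  constructor
  · simp
  · simp; field_simp; ring

theorem turns_swap (ξ : ℝ) : Turns ξ (-1) !![0, 1; 1, 0] (-1) ξ := by
  constructor <;> simp

theorem turns_wordMat {θ : ℝ} (hθ : Irrational θ) {u : List ℕ+}
    (hu : ∀ j, (h : j < u.length) → cfA j θ = ((u.get ⟨j, h⟩ : ℕ) : ℤ)) :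
    ∃ r, Turns 1 (-θ) (wordMat u) r (cq u.length θ) := by
  induction u generalizing θ with
  | nil => exact ⟨1, by constructor <;> simp [wordMat, cq]⟩
  | cons a u ih =>
    have h0 := hu 0 (by simp)
    have ha : ⌊θ⌋ = ((a : ℕ) : ℤ) := h0
    have hne : θ - ((a : ℕ) : ℤ) ≠ 0 := sub_ne_zero.2 (hθ.ne_int _)
    obtain ⟨r, hr⟩ := ih (θ := (θ - ⌊θ⌋)⁻¹) (hθ.sub_intCast _).inv (fun j h => by
      exact hu (j + 1) (by simpa using h))
    refine ⟨_, (turns_letter hne).mul (s := r) ?_⟩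
    rw [← ha]
    exact hr

/-- Data of a unimodular change of variables leading from `ξ` to its `n`-th complete quotient. -/
structure CqState (ξ : ℝ) (n : ℕ) (g : M2) (r : ℝ) : Prop where
  unim : InGL2Z g
  turns : Turns ξ (-1) g r (cq n ξ)
  ne_zero : r ≠ 0
  abs_le : |r| ≤ 1

theorem cqState_zero (ξ : ℝ) : CqState ξ 0 !![0, 1; 1, 0] (-1) :=
  ⟨Or.inr (by simp [Matrix.det_fin_two]), turns_swap ξ, by norm_num, by norm_num⟩

theorem CqState.succ {ξ : ℝ} (hξ : Irrational ξ) {n : ℕ} {g : M2} {r : ℝ} (h : CqState ξ n g r) :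
    ∃ g' r', CqState ξ (n + 1) g' r' ∧ |r' * cq (n + 1) ξ| ≤ 1 ∧
      g' 0 0 = cfA n ξ * g 0 0 + g 0 1 ∧ g' 0 1 = g 0 0 := by
  have hi := hξ.cq n
  have hlt := hi.floor_lt
  have hlt' := Int.lt_floor_add_one (cq n ξ)
  have hne : cq n ξ - ⌊cq n ξ⌋ ≠ 0 := by linarith
  have ht := h.turns.mul (turns_letter hne)
  rw [← cq_succ'] at ht
  refine ⟨_, _, ⟨h.unim.mul (Or.inr (by simp [Matrix.det_fin_two])), ht,
    mul_ne_zero h.ne_zero (by linarith), ?_⟩, ?_, ?_, ?_⟩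
  · rw [abs_mul]
    refine mul_le_one₀ h.abs_le (abs_nonneg _) ?_
    rw [_root_.abs_le]; constructor <;> linarith
  · have : (⌊cq n ξ⌋ - cq n ξ) * cq (n + 1) ξ = -1 := by
      rw [cq_succ', ← neg_sub (cq n ξ), neg_mul, mul_inv_cancel₀ hne]
    rw [mul_assoc, this, mul_neg_one, abs_neg]
    exact h.abs_le
  · rw [cfA_eq_floor_cq]
    simp [Matrix.mul_apply, Fin.sum_univ_two]
    ring
  · simp [Matrix.mul_apply, Fin.sum_univ_two]

theorem exists_cqState {ξ : ℝ} (hξ : Irrational ξ) (n : ℕ) : ∃ g r, CqState ξ n g r := by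
  induction n with
  | zero => exact ⟨_, _, cqState_zero ξ⟩
  | succ n ih =>
    obtain ⟨g, r, h⟩ := ih
    obtain ⟨g', r', h', -⟩ := h.succ hξ
    exact ⟨g', r', h'⟩

theorem exists_cqState_large {ξ : ℝ} (hξ : Irrational ξ) (K : ℕ) :
    ∃ n g r, 1 ≤ n ∧ CqState ξ n g r ∧ |r * cq n ξ| ≤ 1 ∧ (K : ℤ) ≤ g 0 1 ∧
      (K : ℤ) ≤ g 0 0 - g 0 1 := by
  obtain ⟨n, g, r, hn, h, h1, h2⟩ : ∃ n g r, 1 ≤ n ∧ CqState ξ n g r ∧ 1 ≤ g 0 1 ∧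
      (K : ℤ) + 1 ≤ g 0 0 := by
    induction K with
    | zero =>
      obtain ⟨g₁, r₁, s₁, -, a₁, b₁⟩ := (cqState_zero ξ).succ hξ
      obtain ⟨g₂, r₂, s₂, -, a₂, b₂⟩ := s₁.succ hξ
      have := hξ.one_le_cfA (n := 0 + 1) le_rfl
      simp at a₁ b₁
      rw [a₁, b₁] at a₂
      rw [a₁] at b₂
      exact ⟨_, g₂, r₂, by omega, s₂, by omega, by push_cast; linarith⟩
    | succ K ih =>
      obtain ⟨n, g, r, hn, s, h1, h2⟩ := ih
      obtain ⟨g₁, r₁, s₁, -, a₁, b₁⟩ := s.succ hξ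
      have := hξ.one_le_cfA hn
      refine ⟨n + 1, g₁, r₁, by omega, s₁, by omega, ?_⟩
      rw [a₁]; push_cast
      nlinarith
  obtain ⟨g₁, r₁, s₁, -, a₁, b₁⟩ := h.succ hξ
  obtain ⟨g₂, r₂, s₂, t₂, a₂, b₂⟩ := s₁.succ hξ
  have e1 := hξ.one_le_cfA hn
  have e2 := hξ.one_le_cfA (n := n + 1) (by omega)
  have e3 : (K : ℤ) + 1 ≤ g₁ 0 0 := by rw [a₁]; nlinarith
  refine ⟨_, g₂, r₂, by omega, s₂, t₂, by omega, ?_⟩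
  rw [a₂, b₂]; nlinarith

/-! ### Growth of Fibonacci sequences -/

theorem exists_growth_const {p : ℕ → ℝ} (h1 : ∀ i, 1 ≤ i → 1 ≤ p i)
    (hlo : ∀ i, 1 ≤ i → p (i + 1) * p i ≤ p (i + 2))
    (hhi : ∀ i, 1 ≤ i → p (i + 2) ≤ 2 * (p (i + 1) * p i)) :
    ∃ c₁ c₂ : ℝ, 0 < c₁ ∧ 0 < c₂ ∧ ∀ i, 1 ≤ i →
      c₁ * p i ^ gam ≤ p (i + 1) ∧ p (i + 1) ≤ c₂ * p i ^ gam := by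
  have hpos : ∀ i, 1 ≤ i → 0 < p i := fun i hi => by linarith [h1 i hi]
  obtain ⟨D, hD⟩ : ∃ D : ℕ → ℝ, ∀ i, D i = Real.log (p (i + 1)) - gam * Real.log (p i) :=
    ⟨_, fun i => rfl⟩
  have g1 := one_lt_gam
  have g2 := gam_lt_two
  have l2 : 0 < Real.log 2 := Real.log_pos (by norm_num)
  obtain ⟨B, hB⟩ : ∃ B, B = max |D 1| (Real.log 2 / (2 - gam)) := ⟨_, rfl⟩
  have hB2 : Real.log 2 ≤ (2 - gam) * B := by
    have : Real.log 2 / (2 - gam) ≤ B := by rw [hB]; exact le_max_right _ _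
    rwa [div_le_iff₀' (by linarith)] at this
  have hDB : ∀ i, 1 ≤ i → |D i| ≤ B := by
    intro i hi
    induction i, hi using Nat.le_induction with
    | base => rw [hB]; exact le_max_left _ _
    | succ i hi ih =>
      have a1 := hpos i hi
      have a2 := hpos (i + 1) (by omega)
      have a3 := hpos (i + 2) (by omega)
      have b1 := Real.log_le_log (mul_pos a2 a1) (hlo i hi)
      have b2 := Real.log_le_log a3 (hhi i hi)
      rw [Real.log_mul a2.ne' a1.ne'] at b1
      rw [Real.log_mul (by norm_num) (mul_pos a2 a1).ne', Real.log_mul a2.ne' a1.ne'] at b2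
      have key : D (i + 1) = -((gam - 1) * D i) +
          (Real.log (p (i + 2)) - Real.log (p (i + 1)) - Real.log (p i)) := by
        rw [hD, hD]
        linear_combination (-Real.log (p i)) * gam_sq
      rw [abs_le] at ih ⊢
      rw [key]
      constructor <;> nlinarith
  refine ⟨Real.exp (-B), Real.exp B, Real.exp_pos _, Real.exp_pos _, fun i hi => ?_⟩
  have hp : p (i + 1) = Real.exp (D i) * p i ^ gam := by
    rw [Real.rpow_def_of_pos (hpos i hi), ← Real.exp_add, hD, mul_comm gam, sub_add_cancel,
      Real.exp_log (hpos _ (by omega))]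
  have hpw := (Real.rpow_pos_of_pos (hpos i hi) gam).le
  have := abs_le.1 (hDB i hi)
  rw [hp]
  exact ⟨mul_le_mul_of_nonneg_right (Real.exp_le_exp.2 this.1) hpw,
    mul_le_mul_of_nonneg_right (Real.exp_le_exp.2 this.2) hpw⟩

theorem exists_const_of_comparison {p m x : ℕ → ℝ} {c₁ c₂ C a b : ℝ} (hc₁ : 0 < c₁) (hc₂ : 0 < c₂)
    (hC : 0 < C) (ha : 0 < a) (hb : 0 < b) (hp : ∀ i, 1 ≤ i → 0 < p i)
    (hgrow : ∀ i, 1 ≤ i → c₁ * p i ^ gam ≤ p (i + 1) ∧ p (i + 1) ≤ c₂ * p i ^ gam)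
    (hm : ∀ i, 1 ≤ i → p i ≤ C * m i ∧ m i ≤ C * p i)
    (hx : ∀ i, 1 ≤ i → a / p i ≤ x i ∧ x i ≤ b / p i) :
    ∃ d₁ d₂ d₃ d₄ : ℝ, 0 < d₁ ∧ 0 < d₂ ∧ 0 < d₃ ∧ 0 < d₄ ∧ ∀ i, 1 ≤ i →
      d₁ * m i ^ gam ≤ m (i + 1) ∧ m (i + 1) ≤ d₂ * m i ^ gam ∧
      d₃ * (m i)⁻¹ ≤ x i ∧ x i ≤ d₄ * (m i)⁻¹ := by
  have hCg : 0 < C ^ gam := Real.rpow_pos_of_pos hC _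
  refine ⟨c₁ / (C * C ^ gam), c₂ * C * C ^ gam, a / C, b * C, by positivity, by positivity,
    by positivity, by positivity, fun i hi => ?_⟩
  obtain ⟨m1, m2⟩ := hm i hi
  obtain ⟨n1, n2⟩ := hm (i + 1) (by omega)
  obtain ⟨g1, g2⟩ := hgrow i hi
  obtain ⟨x1, x2⟩ := hx i hi
  have hpi := hp i hi
  have hmi : 0 < m i := by
    by_contra h
    nlinarith
  have q1 : m i ^ gam ≤ C ^ gam * p i ^ gam := by
    rw [← Real.mul_rpow hC.le hpi.le]
    exact Real.rpow_le_rpow hmi.le m2 gam_pos.le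
  have q2 : p i ^ gam ≤ C ^ gam * m i ^ gam := by
    rw [← Real.mul_rpow hC.le hmi.le]
    exact Real.rpow_le_rpow hpi.le m1 gam_pos.le
  refine ⟨?_, ?_, ?_, ?_⟩
  · rw [div_mul_eq_mul_div, div_le_iff₀ (by positivity)]
    have := mul_le_mul_of_nonneg_left q1 hc₁.le
    have := mul_le_mul_of_nonneg_left (g1.trans n1) hCg.le
    nlinarith
  · have := mul_le_mul_of_nonneg_left q2 (mul_pos hC hc₂).le
    have := mul_le_mul_of_nonneg_left g2 hC.le
    nlinarith
  · refine le_trans ?_ x1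
    rw [← div_eq_mul_inv, div_div]
    exact div_le_div_of_nonneg_left ha.le hpi m1
  · refine x2.trans ?_
    rw [← div_eq_mul_inv, div_le_div_iff₀ hpi hmi, mul_assoc]
    exact mul_le_mul_of_nonneg_left m2 hb.le

/-! ### Conjugation -/

theorem InGL2Z.exists_inv {g : M2} (hg : InGL2Z g) :
    ∃ k : M2, InGL2Z k ∧ g * k = 1 ∧ k * g = 1 ∧ mnorm k ≤ mnorm g := by
  refine ⟨g.det • g.adjugate, ?_, ?_, ?_, ?_⟩
  · unfold InGL2Z
    rw [Matrix.det_smul, Matrix.det_adjugate]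
    rcases hg with h | h <;> simp [h]
  · rw [Matrix.mul_smul, Matrix.mul_adjugate, smul_smul, hg.det_mul_self, one_smul]
  · rw [Matrix.smul_mul, Matrix.adjugate_mul, smul_smul, hg.det_mul_self, one_smul]
  · rcases hg with h | h
    · rw [h, one_smul]; exact mnorm_adjugate_le g
    · rw [h, neg_smul, one_smul, mnorm_neg]; exact mnorm_adjugate_le g

section Conj

variable {g k : M2}

theorem conj_mul_conj (h : k * g = 1) (A B : M2) : g * (A * B) * k = g * A * k * (g * B * k) := by
  calc g * (A * B) * k = g * A * 1 * B * k := by simp only [Matrix.mul_one, Matrix.mul_assoc]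
    _ = _ := by rw [← h]; simp only [Matrix.mul_assoc]

theorem conj_conj (h : k * g = 1) (A : M2) : k * (g * A * k) * g = A := by
  calc k * (g * A * k) * g = (k * g) * A * (k * g) := by simp only [Matrix.mul_assoc]
    _ = A := by rw [h, Matrix.one_mul, Matrix.mul_one]

theorem commut_conj (h : k * g = 1) (A B : M2) :
    commut (g * A * k) (g * B * k) = g * commut A B * k := by
  rw [commut, commut, ← conj_mul_conj h, ← conj_mul_conj h, Matrix.mul_sub, Matrix.sub_mul]

theorem det_conj (h : k * g = 1) (A : M2) : (g * A * k).det = A.det := by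
  have : k.det * g.det = 1 := by rw [← Matrix.det_mul, h, Matrix.det_one]
  rw [Matrix.det_mul, Matrix.det_mul]
  linear_combination A.det * this

theorem trace_conj (h : k * g = 1) (A : M2) : (g * A * k).trace = A.trace := by
  rw [Matrix.trace_mul_comm, ← Matrix.mul_assoc, h, Matrix.one_mul]

theorem mnorm_conj_le {G : ℝ} (hg : mnorm g ≤ G) (hk : mnorm k ≤ G) (A : M2) :
    mnorm (g * A * k) ≤ 4 * G ^ 2 * mnorm A := by
  have hA := mnorm_nonneg A
  have h0 := mnorm_nonneg g
  calc mnorm (g * A * k) ≤ 2 * mnorm (g * A) * mnorm k := mnorm_mul_le _ _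
    _ ≤ 2 * (2 * mnorm g * mnorm A) * mnorm k := by
        have := mnorm_mul_le g A
        have := mnorm_nonneg k
        gcongr
    _ ≤ 2 * (2 * G * mnorm A) * G := by
        have := h0.trans hg
        have := mnorm_nonneg k
        gcongr
    _ = _ := by ring

end Conj

/-! ### Words and approximation -/

theorem Dominant.mnorm_eq {A : M2} (h : Dominant A) : mnorm A = A 0 0 := by
  obtain ⟨h1, h2, h3, h4, h5, h6, h7⟩ := h
  apply le_antisymm
  · apply mnorm_le
    intro i j
    rw [← Int.cast_abs, Int.cast_le]
    fin_cases i <;> fin_cases j <;> simp <;> rw [abs_le] <;> constructor <;> linarith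
  · exact (le_abs_self _).trans (abs_entry_le_mnorm A 0 0)

theorem Dominant.sq_ne {A : M2} (h : Dominant A) (hA : InGL2Z A) (m : ℤ) :
    A.trace ^ 2 - 4 * A.det ≠ m ^ 2 := by
  obtain ⟨a, b, c, d, rfl⟩ := M2.exists_entries A
  obtain ⟨h1, h2, h3, h4, h5, h6, h7⟩ := h
  simp only [InGL2Z, Matrix.det_fin_two_of, Matrix.trace_fin_two_of] at *
  simp at h1 h2 h3 h4 h5 h6 h7
  intro hm
  have ha : 1 ≤ a := by linarith
  wlog hm0 : 0 ≤ m generalizing m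
  · exact this (-m) (by rw [neg_sq]; exact hm) (by omega)
  rcases hA with hA | hA <;> rw [hA] at hm
  · have ht : 3 ≤ a + d := by
      by_contra hlt
      have : a = 2 ∧ d = 0 ∨ a = 1 ∧ d = 0 ∨ a = 1 ∧ d = 1 := by omega
      rcases this with ⟨rfl, rfl⟩ | ⟨rfl, rfl⟩ | ⟨rfl, rfl⟩ <;> nlinarith
    have h1 : m < a + d := by nlinarith
    rcases (show m + 1 = a + d ∨ m + 2 ≤ a + d by omega) with h2 | h2
    · have : 2 * m = 3 := by rw [← h2] at hm; linarith
      omega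
    · have : (m + 2) ^ 2 ≤ (a + d) ^ 2 := by nlinarith
      nlinarith
  · have h1 : a + d < m := by nlinarith
    rcases (show m = a + d + 1 ∨ a + d + 2 ≤ m by omega) with h2 | h2
    · have : 2 * (a + d) = 3 := by rw [h2] at hm; linarith
      omega
    · have : (a + d + 2) ^ 2 ≤ m ^ 2 := by nlinarith
      nlinarith

theorem turns_bounds {θ τ r : ℝ} {A : M2} (hθ : 1 < θ) (hτ : 1 < τ) (hA : InGL2Z A)
    (hD : Dominant A) (h : Turns 1 (-θ) A r τ) :
    max |r| |r * τ| = |r * τ| ∧ 1 / (2 * A 0 0) ≤ |r * τ| ∧ |r * τ| ≤ (1 + θ) / A 0 0 := by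
  have hdet : r * τ * (A 1 1 + τ * A 1 0) = τ * A.det := by
    rw [Matrix.det_fin_two]
    push_cast
    have e1 := h.fst
    have e2 := h.snd
    linear_combination (τ * A 1 0) * e2 - (τ * A 1 1) * e1
  obtain ⟨h1, h2, h3, h4, h5, h6, h7⟩ := hD
  obtain ⟨a, ha⟩ : ∃ a : ℝ, (A 0 0 : ℝ) = a := ⟨_, rfl⟩
  obtain ⟨c, hc⟩ : ∃ c : ℝ, (A 1 0 : ℝ) = c := ⟨_, rfl⟩
  obtain ⟨d, hd⟩ : ∃ d : ℝ, (A 1 1 : ℝ) = d := ⟨_, rfl⟩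
  have i1 : 0 ≤ d := by rw [← hd]; exact_mod_cast h1
  have i2 : d ≤ c := by rw [← hd, ← hc]; exact_mod_cast h3
  have i3 : c ≤ a := by rw [← ha, ← hc]; exact_mod_cast h5
  have i4 : 1 ≤ c := by rw [← hc]; exact_mod_cast h7
  have e1 := h.fst
  rw [hd, hc] at hdet
  rw [ha, hc] at e1
  rw [ha]
  have hmax : |r| ≤ |r * τ| := by
    rw [abs_mul]
    exact le_mul_of_one_le_right (abs_nonneg r) (hτ.le.trans (le_abs_self τ))
  obtain ⟨y, hy⟩ : ∃ y, y = |r * τ| := ⟨_, rfl⟩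
  have habs : y * (d + τ * c) = τ := by
    rw [hy, ← abs_of_pos (show 0 < d + τ * c by nlinarith), ← abs_mul, hdet, abs_mul, hA.abs_det,
      mul_one, abs_of_pos (by linarith)]
  rw [← hy] at hmax ⊢
  have y0 : 0 < y := by
    by_contra hlt
    nlinarith [show 0 < d + τ * c by nlinarith]
  have yc : y * c ≤ 1 := by
    by_contra hlt
    nlinarith [mul_nonneg y0.le i1]
  refine ⟨max_eq_right hmax, ?_, ?_⟩
  · rw [div_le_iff₀ (by linarith)]
    have : y * d ≤ y * c := by nlinarith
    have : y * c ≤ y * a := by nlinarith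
    have : y * c ≤ τ * (y * c) := by nlinarith [mul_nonneg y0.le (show 0 ≤ c by linarith)]
    nlinarith
  · rw [le_div_iff₀ (by linarith)]
    have : r ≤ y := (le_abs_self r).trans hmax
    have : y ≤ 1 := by nlinarith
    nlinarith [mul_le_mul_of_nonneg_left yc (zero_le_one.trans hθ.le)]

theorem Turns.xiNorm_eq {ξ r θ : ℝ} {A : M2} (h : Turns ξ (-1) A r θ) :
    xiNorm ξ A = max |r| |r * θ| := by
  rw [← abs_neg (r * θ), ← h.snd, ← h.fst, xiNorm]
  simp only [neg_mul, one_mul, sub_eq_add_neg]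

/-! ### From words to extremal numbers -/

theorem tendsto_of_add_one_le {p : ℕ → ℝ} (h : ∀ i, 1 ≤ i → p (i + 1) + 1 ≤ p (i + 2))
    (h2 : 0 ≤ p 2) : Filter.Tendsto p Filter.atTop Filter.atTop := by
  have key : ∀ n : ℕ, (n : ℝ) ≤ p (n + 2) := by
    intro n
    induction n with
    | zero => simpa using h2
    | succ n ih =>
      have := h (n + 1) (by omega)
      push_cast
      linarith
  exact (Filter.tendsto_add_atTop_iff_nat 2).1
    (Filter.tendsto_atTop_mono key tendsto_natCast_atTop_atTop)

theorem dominant_mul_bounds {A B : M2} (hA : Dominant A) (hB : Dominant B) :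
    A 0 0 * B 0 0 ≤ (A * B) 0 0 ∧ (A * B) 0 0 ≤ 2 * (A 0 0 * B 0 0) ∧
      A 0 0 + 1 ≤ (A * B) 0 0 := by
  obtain ⟨h1, h2, h3, h4, h5, h6, h7⟩ := hA
  obtain ⟨k1, k2, k3, k4, k5, k6, k7⟩ := hB
  rw [Matrix.mul_apply, Fin.sum_univ_two]
  refine ⟨?_, ?_, ?_⟩ <;> nlinarith [mul_nonneg (show 0 ≤ A 0 1 by linarith)
    (show 0 ≤ B 1 0 by linarith), mul_le_mul h4 k5 (show 0 ≤ B 1 0 by linarith) (by linarith)]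

open Filter Topology in
theorem extremal_of_words {ξ θ s : ℝ} {g : M2} (hθ : Irrational θ) (hθ1 : 1 < θ) (hg : InGL2Z g)
    (hT : Turns ξ (-1) g s θ) (hs : s ≠ 0) {w : ℕ → List ℕ+} (hne : ∀ i, 1 ≤ i → w i ≠ [])
    (hw : FibWordSeq w) (hcom : w 1 ++ w 2 ≠ w 2 ++ w 1)
    (hpre : ∀ i, 1 ≤ i → ∀ j, (h : j < (w i).length) →
      cfA j θ = (((w i).get ⟨j, h⟩ : ℕ) : ℤ)) :
    IsExtremal ξ ∧ ∃ W : ℕ → M2, IsAssociated ξ W ∧ ∀ i, 1 ≤ i → InGL2Z (W i) := by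
  obtain ⟨k, hk, hgk, hkg, hknorm⟩ := hg.exists_inv
  obtain ⟨M, hM⟩ : ∃ M : ℕ → M2, ∀ i, M i = wordMat (w i) := ⟨_, fun _ => rfl⟩
  obtain ⟨W, hW⟩ : ∃ W : ℕ → M2, ∀ i, W i = g * M i * k := ⟨_, fun _ => rfl⟩
  obtain ⟨p, hp⟩ : ∃ p : ℕ → ℝ, ∀ i, p i = (M i 0 0 : ℝ) := ⟨_, fun _ => rfl⟩
  obtain ⟨G, hG⟩ : ∃ G, G = mnorm g := ⟨_, rfl⟩
  have hG1 : 1 ≤ G := by rw [hG]; exact one_le_mnorm hg.memP.2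
  have hMG : ∀ i, InGL2Z (M i) := fun i => by rw [hM]; exact wordMat_inGL2Z _
  have hMD : ∀ i, 1 ≤ i → Dominant (M i) := fun i hi => by
    rw [hM]; exact wordMat_dominant (hne i hi)
  have hMrec : ∀ i, 1 ≤ i → M (i + 2) = M (i + 1) * M i := fun i hi => by
    rw [hM, hM, hM, hw i hi, wordMat_append]
  have hWG : ∀ i, 1 ≤ i → InGL2Z (W i) := fun i _ => by
    rw [hW]; exact (hg.mul (hMG i)).mul hk
  have hWrec : ∀ i, 1 ≤ i → W (i + 2) = W (i + 1) * W i := fun i hi => by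
    rw [hW, hW, hW, hMrec i hi, conj_mul_conj hkg]
  have hC : (commut (W 1) (W 2)).det ≠ 0 := by
    rw [hW, hW, commut_conj hkg, det_conj hkg]
    intro h0
    have h10 : M 1 1 0 ≠ 0 := by have := (hMD 1 le_rfl).pos10; omega
    have := commut_eq_zero_of_det_eq_zero h10 ((hMD 1 le_rfl).sq_ne (hMG 1)) h0
    rw [commut, sub_eq_zero, hM, hM, ← wordMat_append, ← wordMat_append] at this
    exact hcom (wordMat_injective this)
  have htr : (W 2).trace ≠ 0 := by
    rw [hW, trace_conj hkg, Matrix.trace_fin_two]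
    obtain ⟨h1, h2, h3, h4, h5, h6, h7⟩ := hMD 2 (by norm_num)
    omega
  have hp1 : ∀ i, 1 ≤ i → 1 ≤ p i := fun i hi => by
    obtain ⟨h1, h2, h3, h4, h5, h6, h7⟩ := hMD i hi
    rw [hp]; exact_mod_cast h6.trans h4
  have hpb : ∀ i, 1 ≤ i → p (i + 1) * p i ≤ p (i + 2) ∧ p (i + 2) ≤ 2 * (p (i + 1) * p i) ∧
      p (i + 1) + 1 ≤ p (i + 2) := fun i hi => by
    have := dominant_mul_bounds (hMD (i + 1) (by omega)) (hMD i hi)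
    rw [← hMrec i hi] at this
    rw [hp, hp, hp]
    exact_mod_cast this
  have hptop : Tendsto p atTop atTop :=
    tendsto_of_add_one_le (fun i hi => (hpb i hi).2.2) (by linarith [hp1 2 (by norm_num)])
  obtain ⟨c₁, c₂, hc₁, hc₂, hgrow⟩ := exists_growth_const hp1 (fun i hi => (hpb i hi).1)
    (fun i hi => (hpb i hi).2.1)
  have hpM : ∀ i, 1 ≤ i → mnorm (M i) = p i := fun i hi => by rw [hp, (hMD i hi).mnorm_eq]
  have hm : ∀ i, 1 ≤ i → p i ≤ 4 * G ^ 2 * mnorm (W i) ∧ mnorm (W i) ≤ 4 * G ^ 2 * p i := by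
    intro i hi
    rw [← hpM i hi]
    refine ⟨?_, ?_⟩
    · nth_rewrite 1 [← conj_conj hkg (M i)]
      rw [← hW]
      exact mnorm_conj_le (hknorm.trans hG.ge) hG.ge _
    · rw [hW]
      exact mnorm_conj_le hG.ge (hknorm.trans hG.ge) _
  have hs0 := abs_pos.2 hs
  have hx : ∀ i, 1 ≤ i → |s| / (4 * G) / p i ≤ xiNorm ξ (W i) ∧
      xiNorm ξ (W i) ≤ 2 * |s| * (1 + θ) * G / p i := by
    intro i hi
    obtain ⟨r, hr⟩ := turns_wordMat hθ (hpre i hi)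
    rw [← hM] at hr
    have hlen : 1 ≤ (w i).length := List.length_pos_iff.2 (hne i hi)
    obtain ⟨b1, b2, b3⟩ := turns_bounds hθ1 (hθ.one_lt_cq hlen) (hMG i) (hMD i hi) hr
    have hx0 : xiNorm ξ (g * M i) = |s| * |r * cq (w i).length θ| := by
      rw [(hT.mul hr).xiNorm_eq, mul_assoc, abs_mul, abs_mul, ← mul_max_of_nonneg _ _ hs0.le, b1]
    rw [← hp] at b2 b3
    have hpi := hp1 i hi
    have u1 : xiNorm ξ (W i) ≤ 2 * xiNorm ξ (g * M i) * G := by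
      rw [hW]
      refine (xiNorm_mul_le _ _ _).trans ?_
      have := xiNorm_nonneg ξ (g * M i)
      have := hknorm.trans hG.ge
      gcongr
    have u2 : xiNorm ξ (g * M i) ≤ 2 * xiNorm ξ (W i) * G := by
      have : g * M i = W i * g := by
        rw [hW, Matrix.mul_assoc, hkg, Matrix.mul_one]
      rw [this, hG]
      exact xiNorm_mul_le _ _ _
    rw [hx0] at u1 u2
    constructor
    · rw [div_div, div_le_iff₀ (by positivity)]
      rw [div_le_iff₀ (by positivity)] at b2
      nlinarith [mul_le_mul_of_nonneg_left b2 hs0.le, mul_le_mul_of_nonneg_right u2 (by positivity : 0 ≤ 2 * p i)]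
    · rw [le_div_iff₀ (by positivity)]
      rw [le_div_iff₀ (by positivity)] at b3
      nlinarith [mul_le_mul_of_nonneg_left b3 (by positivity : 0 ≤ 2 * |s| * G), mul_le_mul_of_nonneg_right u1 (by positivity : 0 ≤ p i)]
  have hp0 : ∀ i, 1 ≤ i → 0 < p i := fun i hi => zero_lt_one.trans_le (hp1 i hi)
  obtain ⟨d₁, d₂, d₃, d₄, hd₁, hd₂, hd₃, hd₄, hd⟩ := exists_const_of_comparison
    (m := fun i => mnorm (W i)) (x := fun i => xiNorm ξ (W i)) hc₁ hc₂
    (by positivity : 0 < 4 * G ^ 2) (by positivity : 0 < |s| / (4 * G))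
    (by positivity : 0 < 2 * |s| * (1 + θ) * G) hp0 hgrow hm hx
  have hub : UnboundedSeq W := by
    intro C
    obtain ⟨i, hi⟩ := ((hptop.eventually_gt_atTop (4 * G ^ 2 * C)).and
      (eventually_ge_atTop 1)).exists
    refine ⟨i, hi.2, ?_⟩
    have := hi.1.trans_le (hm i hi.2).1
    exact lt_of_mul_lt_mul_left this (by positivity)
  have hlim : Tendsto (fun i => xiNorm ξ (W i)) atTop (𝓝 0) := by
    refine tendsto_of_tendsto_of_tendsto_of_le_of_le' tendsto_const_nhds
      (hptop.const_div_atTop (2 * |s| * (1 + θ) * G)) ?_ ?_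
    · exact Eventually.of_forall fun i => xiNorm_nonneg _ _
    · filter_upwards [eventually_ge_atTop 1] with i hi using (hx i hi).2
  refine ⟨⟨rat_of_int_not_quadratic fun a b c h => int_not_quadratic hWG hWrec hC hlim h,
    exists_extremal_points hWG (admMat_ne_zero_det hWG hC) (mul_admMat_isSymm hWG hWrec) hub
      hd₂ hd₄ (fun i hi => (hd i hi).2.1) (fun i hi => (hd i hi).2.2.2)⟩, W, ⟨⟨?_, ?_⟩, hub,
    admissibleFib_of_unimodular hWG hWrec hC htr, d₁, d₂, d₃, d₄, 1, 1, hd₁, hd₂, hd₃, hd₄,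
    one_pos, one_pos, fun i hi => ?_⟩, hWG⟩
  · exact fun i hi => (hWG i hi).memP
  · intro i hi
    rw [pmul_of_inGL2Z (hWG _ (by omega)) (hWG i hi), hWrec i hi]
  · obtain ⟨e1, e2, e3, e4⟩ := hd i hi
    exact ⟨e1, e2, e3, e4, (hWG i hi).abs_det.ge, (hWG i hi).abs_det.le⟩

theorem cfA_prepend {θ : ℝ} (hθ : 1 < θ) (a : ℤ) :
    cfA 0 (a + θ⁻¹) = a ∧ ∀ j, cfA (j + 1) (a + θ⁻¹) = cfA j θ := by
  have hfl : ⌊(a : ℝ) + θ⁻¹⌋ = a := by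
    rw [Int.floor_eq_iff]
    have h1 := inv_pos.2 (zero_lt_one.trans hθ)
    have h2 := inv_lt_one_of_one_lt₀ hθ
    constructor <;> linarith
  refine ⟨hfl, fun j => ?_⟩
  rw [cfA, hfl, add_sub_cancel_left, inv_inv]

theorem exists_turns_of_shift {ξ θ s : ℝ} {g : M2} {b : ℕ → ℕ+} {l : ℕ} (hθ : Irrational θ)
    (hθ1 : 1 < θ) (hg : InGL2Z g) (hT : Turns ξ (-1) g s θ) (hs : s ≠ 0)
    (hb : ∀ j, cfA j θ = ((b (l + j + 1) : ℕ) : ℤ)) :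
    ∃ (θ s : ℝ) (g : M2), Irrational θ ∧ 1 < θ ∧ InGL2Z g ∧ Turns ξ (-1) g s θ ∧ s ≠ 0 ∧
      ∀ j, cfA j θ = ((b (j + 1) : ℕ) : ℤ) := by
  induction l generalizing θ s g with
  | zero => exact ⟨θ, s, g, hθ, hθ1, hg, hT, hs, by simpa using hb⟩
  | succ l ih =>
    have h0 : 0 < θ := zero_lt_one.trans hθ1
    obtain ⟨a, ha⟩ : ∃ a : ℤ, a = ((b (l + 1) : ℕ) : ℤ) := ⟨_, rfl⟩
    obtain ⟨h1, h2⟩ := cfA_prepend hθ1 a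
    refine ih (θ := a + θ⁻¹) (hθ.inv.intCast_add a) ?_
      (hg.mul (Or.inr (by simp [Matrix.det_fin_two]))) (hT.mul (turns_letter_inv a h0.ne'))
      (mul_ne_zero hs (neg_ne_zero.2 h0.ne')) fun j => ?_
    · have := inv_pos.2 h0
      have : (1 : ℝ) ≤ a := by rw [ha]; exact_mod_cast PNat.one_le_cast_int _
      linarith
    · cases j with
      | zero => rw [h1, ha, add_zero]
      | succ j => rw [h2, hb, Nat.add_right_comm l 1 j, Nat.add_assoc l j 1]

theorem extremal_of_limit_word {ξ : ℝ} (hξ : Irrational ξ) {w : ℕ → List ℕ+} {b : ℕ → ℕ+}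
    {k l : ℕ} (hw : FibWordSeq w) (hcom : w 1 ++ w 2 ≠ w 2 ++ w 1) (hlim : IsLimitWord w b)
    (h : ∀ i, 1 ≤ i → cfA (k + i) ξ = ((b (l + i) : ℕ) : ℤ)) :
    IsExtremal ξ ∧ ∃ W : ℕ → M2, IsAssociated ξ W ∧ ∀ i, 1 ≤ i → InGL2Z (W i) := by
  obtain ⟨g₀, s₀, h₀⟩ := exists_cqState hξ (k + 1)
  obtain ⟨θ, s, g, hθ, hθ1, hg, hT, hs, hb⟩ := exists_turns_of_shift (hξ.cq (k + 1))
    (hξ.one_lt_cq (by omega)) h₀.unim h₀.turns h₀.ne_zero (b := b) (l := l) (fun j => by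
      rw [← cfA_add, Nat.add_assoc, Nat.add_comm 1 j, h _ (by omega), Nat.add_assoc])
  have h2 : w 2 ≠ [] := fun h => hcom (by simp [h])
  refine extremal_of_words hθ hθ1 hg hT hs (w := fun i => w (i + 1)) (fun i hi => ?_)
    (fun i hi => hw (i + 1) (by omega)) ?_ fun i hi j hj => ?_
  · induction i, hi using Nat.le_induction with
    | base => exact h2
    | succ i hi ih =>
      simp only [hw i hi]
      exact List.append_ne_nil_of_left_ne_nil ih _
  · intro h'
    simp only [hw 1 le_rfl, Nat.reduceAdd, List.append_assoc] at h'
    exact hcom (List.append_cancel_left h').symm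
  · rw [hlim.2 (i + 1) (by omega) j hj, hb]

/-! ### From extremal numbers to words -/

open Filter Topology in
theorem tendsto_mnorm_atTop {W : ℕ → M2} {c : ℝ} (hub : UnboundedSeq W) (hc : 0 < c)
    (h : ∀ i, 1 ≤ i → c * mnorm (W i) ^ gam ≤ mnorm (W (i + 1))) :
    Tendsto (fun i => mnorm (W i)) atTop atTop := by
  have hev := (tendsto_rpow_atTop (sub_pos.2 one_lt_gam)).eventually_ge_atTop (2 / c)
  obtain ⟨T, hT⟩ := eventually_atTop.1 hev
  obtain ⟨i₀, hi₀, hlt⟩ := hub (max T 1)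
  have step : ∀ i, 1 ≤ i → max T 1 ≤ mnorm (W i) → mnorm (W i) + 1 ≤ mnorm (W (i + 1)) := by
    intro i hi hm
    have h1 : 1 ≤ mnorm (W i) := (le_max_right _ _).trans hm
    have h2 := hT _ ((le_max_left _ _).trans hm)
    rw [div_le_iff₀ hc] at h2
    have h3 := h i hi
    have h4 : mnorm (W i) ^ gam = mnorm (W i) ^ (gam - 1) * mnorm (W i) := by
      rw [← Real.rpow_add_one (by linarith), sub_add_cancel]
    nlinarith
  have key : ∀ n : ℕ, max T 1 + n ≤ mnorm (W (n + i₀)) := by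
    intro n
    induction n with
    | zero => simpa using hlt.le
    | succ n ih =>
      have := step (n + i₀) (by omega) (by linarith [n.cast_nonneg (α := ℝ)])
      rw [Nat.add_right_comm]
      push_cast
      linarith
  exact (tendsto_add_atTop_iff_nat i₀).1 (tendsto_atTop_mono key
    (tendsto_atTop_add_const_left _ _ tendsto_natCast_atTop_atTop))

theorem commute_fib {W : ℕ → M2} (hrec : ∀ i, 1 ≤ i → W (i + 2) = W (i + 1) * W i) {a : ℕ}
    (ha : 1 ≤ a) (h : Commute (W a) (W (a + 1))) (n : ℕ) :
    Commute (W a) (W (a + n)) ∧ Commute (W a) (W (a + n + 1)) := by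
  induction n with
  | zero => exact ⟨Commute.refl _, h⟩
  | succ n ih => exact ⟨ih.2, by
      rw [← Nat.add_assoc, hrec (a + n) (by omega)]; exact ih.2.mul_right ih.1⟩

open Filter Topology in
theorem eq_scalar_of_commute {ξ : ℝ} {W : ℕ → M2} (hG : ∀ i, 1 ≤ i → InGL2Z (W i))
    (hrec : ∀ i, 1 ≤ i → W (i + 2) = W (i + 1) * W i)
    (hlim : Tendsto (fun i => xiNorm ξ (W i)) atTop (𝓝 0))
    (hquad : ∀ a b c : ℤ, a * ξ ^ 2 + b * ξ + c = 0 → a = 0 ∧ b = 0 ∧ c = 0) {a : ℕ}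
    (ha : 1 ≤ a) (h : Commute (W a) (W (a + 1))) : W a = (W a 0 0) • (1 : M2) := by
  obtain ⟨B, hB⟩ : ∃ B, B = W a := ⟨_, rfl⟩
  obtain ⟨f, hf⟩ : ∃ f : ℕ → Fin 2 → ℝ, ∀ n j, f n j = ξ * W (a + n) 0 j - W (a + n) 1 j :=
    ⟨_, fun _ _ => rfl⟩
  have hlim' : Tendsto (fun n => xiNorm ξ (W (a + n))) atTop (𝓝 0) := by
    simpa only [add_comm] using (tendsto_add_atTop_iff_nat a).2 hlim
  have hf0 : Tendsto (fun n => f n 0) atTop (𝓝 0) :=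
    squeeze_zero_norm (fun n => by rw [hf]; exact le_max_left _ _) hlim'
  have hf1 : Tendsto (fun n => f n 1) atTop (𝓝 0) :=
    squeeze_zero_norm (fun n => by rw [hf]; exact le_max_right _ _) hlim'
  obtain ⟨D, hD⟩ : ∃ D : ℝ, D = -(ξ * B 0 0 - B 1 0) - ξ * (ξ * B 0 1 - B 1 1) := ⟨_, rfl⟩
  have key : ∀ n, D * (W (a + n)).det =
      (f n 0 * B 0 0 + f n 1 * B 1 0) * f n 1 - (f n 0 * B 0 1 + f n 1 * B 1 1) * f n 0 := by
    intro n
    have hc : B * W (a + n) = W (a + n) * B := by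
      rw [hB]; exact (commute_fib hrec ha h n).1
    have e : ∀ i j, (B i 0 : ℝ) * W (a + n) 0 j + B i 1 * W (a + n) 1 j =
        W (a + n) i 0 * B 0 j + W (a + n) i 1 * B 1 j := by
      intro i j
      have := congrFun (congrFun hc i) j
      rw [Matrix.mul_apply, Matrix.mul_apply, Fin.sum_univ_two, Fin.sum_univ_two] at this
      exact_mod_cast this
    have g0 : f n 0 * B 0 0 + f n 1 * B 1 0 = (ξ * B 0 0 - B 1 0) * W (a + n) 0 0 +
        (ξ * B 0 1 - B 1 1) * W (a + n) 1 0 := by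
      rw [hf, hf]; linear_combination e 1 0 - ξ * e 0 0
    have g1 : f n 0 * B 0 1 + f n 1 * B 1 1 = (ξ * B 0 0 - B 1 0) * W (a + n) 0 1 +
        (ξ * B 0 1 - B 1 1) * W (a + n) 1 1 := by
      rw [hf, hf]; linear_combination e 1 1 - ξ * e 0 1
    rw [g0, g1, hf, hf, hD, Matrix.det_fin_two]
    push_cast
    ring
  have hDlim : Tendsto (fun n => D * ((W (a + n)).det : ℝ)) atTop (𝓝 0) := by
    simp only [key]
    have := (((hf0.mul_const (B 0 0 : ℝ)).add (hf1.mul_const (B 1 0 : ℝ))).mul hf1).sub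
      (((hf0.mul_const (B 0 1 : ℝ)).add (hf1.mul_const (B 1 1 : ℝ))).mul hf0)
    simpa using this
  have hD0 : |D| = 0 := by
    have h1 := hDlim.abs
    simp only [abs_mul, fun n => (hG (a + n) (by omega)).abs_det, mul_one, abs_zero] at h1
    exact tendsto_nhds_unique tendsto_const_nhds h1
  rw [abs_eq_zero, hD] at hD0
  obtain ⟨q1, q2, q3⟩ := hquad (-B 0 1) (B 1 1 - B 0 0) (B 1 0) (by
    push_cast; linear_combination hD0)
  rw [← hB]
  ext i j
  fin_cases i <;> fin_cases j <;> simp <;> omega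

/-- The entries decrease strictly to the right and downwards, and are positive. -/
def StrictDec (a b c d : ℝ) : Prop := 0 < d ∧ d < b ∧ d < c ∧ b < a ∧ c < a

theorem StrictDec.of_mul {a b c d q : ℝ} (h : StrictDec (a * q) (b * q) (c * q) (d * q)) :
    StrictDec a b c d ∨ StrictDec (-a) (-b) (-c) (-d) := by
  obtain ⟨h1, h2, h3, h4, h5⟩ := h
  rcases lt_trichotomy q 0 with hq | rfl | hq
  · right
    refine ⟨?_, ?_, ?_, ?_, ?_⟩ <;> nlinarith
  · simp at h1
  · left
    refine ⟨?_, ?_, ?_, ?_, ?_⟩ <;> nlinarith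

open Filter Topology in
theorem eventually_strictDec {f : Fin 2 → Fin 2 → ℕ → ℝ} {l : Filter ℕ} {α θ u v : ℝ}
    (hα : 0 < α) (hθ : 1 < θ) (hv : 0 < v) (huv : v < u)
    (h0 : ∀ j, Tendsto (f 0 j) l (𝓝 (α * θ * ![u, v] j)))
    (h1 : ∀ j, Tendsto (f 1 j) l (𝓝 (α * ![u, v] j))) :
    ∀ᶠ i in l, StrictDec (f 0 0 i) (f 0 1 i) (f 1 0 i) (f 1 1 i) := by
  have e00 := h0 0
  have e01 := h0 1
  have e10 := h1 0
  have e11 := h1 1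
  simp only [Matrix.cons_val_zero, Matrix.cons_val_one] at e00 e01 e10 e11
  have hu := hv.trans huv
  have hαv := mul_pos hα hv
  have hαu := mul_pos hα hu
  filter_upwards [e11.eventually (lt_mem_nhds hαv), e11.eventually_lt e01 (by nlinarith),
    e11.eventually_lt e10 (by nlinarith), e01.eventually_lt e00
      (mul_lt_mul_of_pos_left huv (by positivity)), e10.eventually_lt e00 (by nlinarith)] with
    i a b c d e using ⟨a, b, c, d, e⟩

/-- The value at `ξ` of the quadratic polynomial attached to a matrix. -/
def quadVal (ξ : ℝ) (N : M2) : ℝ := N 0 0 * ξ ^ 2 - (N 0 1 + N 1 0) * ξ + N 1 1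

theorem ne_zero_of_xiNorm_lt {ξ : ℝ} {S : M2} (hS : S.IsSymm) (hd : S.det ≠ 0)
    (h : xiNorm ξ S < 1) : S 0 0 ≠ 0 := by
  intro h00
  have h01 : S 0 1 = S 1 0 := hS.apply 1 0
  have e0 : |ξ * (S 0 0 : ℝ) - (S 1 0 : ℝ)| < 1 := (le_max_left _ _).trans_lt h
  rw [h00, Int.cast_zero, mul_zero, zero_sub, abs_neg, ← Int.cast_abs] at e0
  have h10 : S 1 0 = 0 := Int.abs_lt_one_iff.1 (by exact_mod_cast e0)
  exact hd (by rw [Matrix.det_fin_two, h00, h01, h10]; ring)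

theorem abs_div_int_le (x : ℝ) (n : ℤ) : |x / n| ≤ |x| := by
  rcases eq_or_ne n 0 with rfl | hn
  · simp
  · rw [abs_div]
    refine div_le_self (abs_nonneg x) ?_
    rw [← Int.cast_abs]
    exact_mod_cast Int.one_le_abs hn

open Filter Topology in
theorem tendsto_entries {ξ θ r : ℝ} {g k N : M2} {W : ℕ → M2} {l : Filter ℕ}
    (hkg : k * g = 1) (hT : Turns ξ (-1) g r θ) (hα : 0 < g 0 0 * θ + g 0 1) (hN : N.det ≠ 0)
    (hW : ∀ᶠ i in l, (W i).det ≠ 0) (hS : ∀ᶠ i in l, (W i * N).IsSymm)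
    (hlim : Tendsto (fun i => xiNorm ξ (W i)) l (𝓝 0)) (a b : Fin 2) :
    Tendsto (fun i => ((k * W i * g) a b : ℝ) * (N.det / (W i * N) 0 0)) l
      (𝓝 ((g 0 0 * θ + g 0 1)⁻¹ * ![θ, 1] a *
        ((N 1 1 - ξ * N 1 0) * g 0 b + (ξ * N 0 0 - N 0 1) * g 1 b))) := by
  obtain ⟨δ, hδ⟩ : ∃ δ : Fin 2 → ℕ → ℝ, ∀ j i, δ j i =
      (ξ * ((W i * N) 0 j : ℝ) - (W i * N) 1 j) / ((W i * N) 0 0 : ℤ) := ⟨_, fun _ _ => rfl⟩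
  have hSlim : Tendsto (fun i => xiNorm ξ (W i * N)) l (𝓝 0) := by
    refine squeeze_zero (fun i => xiNorm_nonneg _ _) (fun i => xiNorm_mul_le _ _ _) ?_
    simpa using (hlim.const_mul 2).mul_const (mnorm N)
  have hδ0 : ∀ j, Tendsto (δ j) l (𝓝 0) := by
    intro j
    refine squeeze_zero_norm (fun i => ?_) hSlim
    rw [hδ, Real.norm_eq_abs]
    refine (abs_div_int_le _ _).trans ?_
    fin_cases j
    · exact le_max_left _ _
    · exact le_max_right _ _
  obtain ⟨P, hP⟩ : ∃ P, P = N.adjugate * g := ⟨_, rfl⟩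
  have hP' : ∀ c, (P 0 c : ℝ) = N 1 1 * g 0 c - N 0 1 * g 1 c ∧
      (P 1 c : ℝ) = -N 1 0 * g 0 c + N 0 0 * g 1 c := by
    intro c
    constructor <;> rw [hP, Matrix.adjugate_fin_two, Matrix.mul_apply, Fin.sum_univ_two] <;>
      simp <;> ring
  have hlimval : (k a 0 + k a 1 * ξ) * (P 0 b + ξ * P 1 b) =
      (g 0 0 * θ + g 0 1)⁻¹ * ![θ, 1] a *
        ((N 1 1 - ξ * N 1 0) * g 0 b + (ξ * N 0 0 - N 0 1) * g 1 b) := by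
    have hk : ∀ c d, (k c 0 : ℝ) * g 0 d + k c 1 * g 1 d = ((1 : M2) c d : ℤ) := by
      intro c d
      have := congrFun (congrFun hkg c) d
      rw [Matrix.mul_apply, Fin.sum_univ_two] at this
      exact_mod_cast this
    have h1 : (g 1 0 : ℝ) * θ + g 1 1 = ξ * (g 0 0 * θ + g 0 1) := by
      linear_combination (-θ) * hT.fst - hT.snd
    have h2 : ∀ a, (k a 0 + k a 1 * ξ) * (g 0 0 * θ + g 0 1) = ![θ, 1] a := by
      have e00 := hk 0 0
      have e01 := hk 0 1
      have e10 := hk 1 0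
      have e11 := hk 1 1
      simp at e00 e01 e10 e11
      refine Fin.forall_fin_two.2 ⟨?_, ?_⟩ <;> simp
      · linear_combination θ * e00 + e01 - (k 0 1 : ℝ) * h1
      · linear_combination θ * e10 + e11 - (k 1 1 : ℝ) * h1
    rw [(hP' b).1, (hP' b).2, ← h2 a]
    field_simp
    ring
  rw [← hlimval]
  have hpoly : Tendsto (fun i => k a 0 * (P 0 b + (ξ - δ 0 i) * P 1 b) +
      k a 1 * ((ξ - δ 0 i) * P 0 b + (ξ * (ξ - δ 0 i) - δ 1 i) * P 1 b)) l
      (𝓝 ((k a 0 + k a 1 * ξ) * (P 0 b + ξ * P 1 b))) := by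
    have t0 : Tendsto (fun i => ξ - δ 0 i) l (𝓝 ξ) := by simpa using (hδ0 0).const_sub ξ
    have t1 : Tendsto (fun i => ξ * (ξ - δ 0 i) - δ 1 i) l (𝓝 (ξ * ξ)) := by
      simpa using (t0.const_mul ξ).sub (hδ0 1)
    have := (((t0.mul_const (P 1 b : ℝ)).const_add (P 0 b : ℝ)).const_mul (k a 0 : ℝ)).add
      (((t0.mul_const (P 0 b : ℝ)).add (t1.mul_const (P 1 b : ℝ))).const_mul (k a 1 : ℝ))
    convert this using 2
    ring
  refine hpoly.congr' ?_
  filter_upwards [hW, hS, hSlim.eventually (gt_mem_nhds zero_lt_one)] with i hi hs hlt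
  have hx0 := ne_zero_of_xiNorm_lt hs (by rw [Matrix.det_mul]; exact mul_ne_zero hi hN) hlt
  have hs01 : (W i * N) 0 1 = (W i * N) 1 0 := hs.apply 1 0
  have hM : N.det • (k * W i * g) = k * (W i * N) * P := by
    rw [hP]
    calc N.det • (k * W i * g) = k * W i * (N.det • (1 : M2)) * g := by
          rw [Matrix.mul_smul, Matrix.mul_one, Matrix.smul_mul]
      _ = _ := by rw [← Matrix.mul_adjugate]; simp only [Matrix.mul_assoc]
  have hMab : (N.det : ℝ) * ((k * W i * g) a b : ℤ) =
      (k a 0 * (W i * N) 0 0 + k a 1 * (W i * N) 1 0) * P 0 b +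
      (k a 0 * (W i * N) 0 1 + k a 1 * (W i * N) 1 1) * P 1 b := by
    have e : ∀ (X Y : M2) i j, (X * Y) i j = X i 0 * Y 0 j + X i 1 * Y 1 j :=
      fun X Y i j => by rw [Matrix.mul_apply, Fin.sum_univ_two]
    have := congrFun (congrFun hM a) b
    rw [Matrix.smul_apply, smul_eq_mul, e _ P, e k, e k] at this
    exact_mod_cast this
  rw [hδ, hδ]
  generalize W i * N = S at *
  have hx0' : (S 0 0 : ℝ) ≠ 0 := by exact_mod_cast hx0
  rw [mul_div_assoc', mul_comm _ (N.det : ℝ), hMab, hs01]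
  field_simp
  ring

open Filter Topology in
theorem eventually_strictDec_conj {ξ θ r : ℝ} {g k N : M2} {W : ℕ → M2} {l : Filter ℕ} {K : ℝ}
    (hkg : k * g = 1) (hT : Turns ξ (-1) g r θ) (hθ : 1 < θ) (hr : |r| ≤ 1) (hrθ : |r * θ| ≤ 1)
    (hg1 : K ≤ g 0 1) (hg0 : K ≤ g 0 0 - g 0 1)
    (hK : 2 * |ξ * N 0 0 - N 0 1| < |quadVal ξ N| * K) (hN : N.det ≠ 0)
    (hW : ∀ᶠ i in l, (W i).det ≠ 0) (hS : ∀ᶠ i in l, (W i * N).IsSymm)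
    (hlim : Tendsto (fun i => xiNorm ξ (W i)) l (𝓝 0)) :
    ∀ᶠ i in l, StrictDec ((k * W i * g) 0 0) ((k * W i * g) 0 1) ((k * W i * g) 1 0)
        ((k * W i * g) 1 1) ∨
      StrictDec (-(k * W i * g) 0 0) (-(k * W i * g) 0 1) (-(k * W i * g) 1 0)
        (-(k * W i * g) 1 1) := by
  have hKpos : 0 < K := by
    by_contra! h
    nlinarith [abs_nonneg (quadVal ξ N), abs_nonneg (ξ * N 0 0 - N 0 1 : ℝ)]
  have hα : 0 < g 0 0 * θ + g 0 1 := by nlinarith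
  obtain ⟨t, ht⟩ : ∃ t : ℝ, t = ξ * N 0 0 - N 0 1 := ⟨_, rfl⟩
  obtain ⟨F, hF⟩ : ∃ F : Fin 2 → ℝ, ∀ b, F b =
    (N 1 1 - ξ * N 1 0) * g 0 b + (ξ * N 0 0 - N 0 1) * g 1 b := ⟨_, fun _ => rfl⟩
  have hent := tendsto_entries hkg hT hα hN hW hS hlim
  simp only [← hF] at hent
  have hu : F 0 = quadVal ξ N * g 0 0 - t * r := by
    rw [hF, ht, quadVal]; linear_combination (-(ξ * N 0 0 - N 0 1)) * hT.fst
  have hv : F 1 = quadVal ξ N * g 0 1 + t * (r * θ) := by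
    rw [hF, ht, quadVal]; linear_combination (-(ξ * N 0 0 - N 0 1)) * hT.snd
  rw [← ht] at hK
  have b1 : |t * r| ≤ |t| := by
    rw [abs_mul]; exact mul_le_of_le_one_right (abs_nonneg t) hr
  have b2 : |t * (r * θ)| ≤ |t| := by
    rw [abs_mul]; exact mul_le_of_le_one_right (abs_nonneg t) hrθ
  rw [abs_le] at b1 b2
  have ht0 := abs_nonneg t
  have main : ∀ ε : ℝ, ε * quadVal ξ N = |quadVal ξ N| → |ε| = 1 →
      0 < ε * F 1 ∧ ε * F 1 < ε * F 0 := by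
    intro ε hε hε1
    have c1 : |quadVal ξ N| * K ≤ |quadVal ξ N| * g 0 1 :=
      mul_le_mul_of_nonneg_left hg1 (abs_nonneg _)
    have c2 : |quadVal ξ N| * K ≤ |quadVal ξ N| * (g 0 0 - g 0 1) :=
      mul_le_mul_of_nonneg_left hg0 (abs_nonneg _)
    have e1 : ε * F 1 = |quadVal ξ N| * g 0 1 + ε * (t * (r * θ)) := by rw [hv, ← hε]; ring
    have e0 : ε * F 0 = |quadVal ξ N| * g 0 0 - ε * (t * r) := by rw [hu, ← hε]; ring
    rw [e0, e1]
    rcases eq_or_eq_neg_of_abs_eq hε1 with rfl | rfl <;> constructor <;> linarith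
  obtain ⟨ε, hε, hε1⟩ : ∃ ε : ℝ, ε * quadVal ξ N = |quadVal ξ N| ∧ |ε| = 1 := by
    rcases abs_choice (quadVal ξ N) with h | h
    · exact ⟨1, by rw [h, one_mul], abs_one⟩
    · exact ⟨-1, by rw [h]; ring, by simp⟩
  obtain ⟨hv0, huv⟩ := main ε hε hε1
  have hα' := inv_pos.2 hα
  have hfin := eventually_strictDec (l := l)
    (f := fun a b i => ε * (((k * W i * g) a b : ℝ) * (N.det / (W i * N) 0 0)))
    hα' hθ hv0 huv
    (fun j => by
      have := (hent 0 j).const_mul ε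
      convert this using 2
      fin_cases j <;> simp <;> ring)
    (fun j => by
      have := (hent 1 j).const_mul ε
      convert this using 2
      fin_cases j <;> simp <;> ring)
  filter_upwards [hfin] with i hi
  refine StrictDec.of_mul (q := ε * (N.det / (W i * N) 0 0)) ?_
  convert hi using 1 <;> ring

theorem quadVal_transpose (ξ : ℝ) (N : M2) : quadVal ξ Nᵀ = quadVal ξ N := by
  simp only [quadVal, Matrix.transpose_apply]; ring

theorem quadVal_ne_zero {ξ : ℝ} {N : M2} (hN : N ≠ -Nᵀ)
    (hquad : ∀ a b c : ℤ, a * ξ ^ 2 + b * ξ + c = 0 → a = 0 ∧ b = 0 ∧ c = 0) :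
    quadVal ξ N ≠ 0 := by
  intro h
  obtain ⟨h1, h2, h3⟩ := hquad (N 0 0) (-(N 0 1 + N 1 0)) (N 1 1) (by
    rw [quadVal] at h; push_cast; linear_combination h)
  apply hN
  ext i j
  fin_cases i <;> fin_cases j <;> simp <;> omega

open Filter Topology in
/-- After conjugation, the matrices are, up to sign, eventually products of letters. -/
theorem exists_strictDec_conj {ξ : ℝ} {N : M2} {W : ℕ → M2} (hξ : Irrational ξ)
    (hG : ∀ i, 1 ≤ i → InGL2Z (W i)) (hlim : Tendsto (fun i => xiNorm ξ (W i)) atTop (𝓝 0))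
    (hquad : ∀ a b c : ℤ, a * ξ ^ 2 + b * ξ + c = 0 → a = 0 ∧ b = 0 ∧ c = 0)
    (hNd : N.det ≠ 0) (hN : N ≠ -Nᵀ)
    (hS : ∀ i, 1 ≤ i → (W i * (if i % 2 = 1 then Nᵀ else N)).IsSymm) :
    ∃ n g k r i₀, 1 ≤ n ∧ 1 ≤ i₀ ∧ CqState ξ n g r ∧ InGL2Z k ∧ g * k = 1 ∧ k * g = 1 ∧
      ∀ i, i₀ ≤ i → StrictDec ((k * W i * g) 0 0) ((k * W i * g) 0 1) ((k * W i * g) 1 0)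
        ((k * W i * g) 1 1) ∨
      StrictDec (-(k * W i * g) 0 0) (-(k * W i * g) 0 1) (-(k * W i * g) 1 0)
        (-(k * W i * g) 1 1) := by
  have hq : 0 < |quadVal ξ N| := abs_pos.2 (quadVal_ne_zero hN hquad)
  obtain ⟨K₁, hK₁⟩ := exists_nat_gt (2 * |ξ * N 0 0 - N 0 1| / |quadVal ξ N|)
  obtain ⟨K₂, hK₂⟩ := exists_nat_gt (2 * |ξ * Nᵀ 0 0 - Nᵀ 0 1| / |quadVal ξ N|)
  rw [div_lt_iff₀' hq] at hK₁ hK₂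
  obtain ⟨n, g, r, hn, h, hrθ, hg1, hg0⟩ := exists_cqState_large hξ (max K₁ K₂)
  obtain ⟨k, hk, hgk, hkg, -⟩ := h.unim.exists_inv
  have hg1' : ((max K₁ K₂ : ℕ) : ℝ) ≤ g 0 1 := by exact_mod_cast hg1
  have hg0' : ((max K₁ K₂ : ℕ) : ℝ) ≤ g 0 0 - g 0 1 := by exact_mod_cast hg0
  have hle₁ : |quadVal ξ N| * K₁ ≤ |quadVal ξ N| * (max K₁ K₂ : ℕ) :=
    mul_le_mul_of_nonneg_left (by exact_mod_cast le_max_left _ _) hq.le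
  have hle₂ : |quadVal ξ N| * K₂ ≤ |quadVal ξ N| * (max K₁ K₂ : ℕ) :=
    mul_le_mul_of_nonneg_left (by exact_mod_cast le_max_right _ _) hq.le
  have hdet : ∀ᶠ i in atTop, (W i).det ≠ 0 := by
    filter_upwards [eventually_ge_atTop 1] with i hi
    rcases hG i hi with h | h <;> rw [h] <;> norm_num
  have hθ := hξ.one_lt_cq hn
  have hodd := eventually_strictDec_conj (l := atTop ⊓ 𝓟 {i | i % 2 = 1}) (N := Nᵀ) hkg h.turns
    hθ h.abs_le hrθ hg1' hg0' (by rw [quadVal_transpose]; exact hK₂.trans_le hle₂)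
    (by rwa [Matrix.det_transpose]) (hdet.filter_mono inf_le_left)
    (by
      rw [eventually_inf_principal]
      filter_upwards [eventually_ge_atTop 1] with i hi hi2
      have := hS i hi
      rwa [if_pos hi2] at this) (hlim.mono_left inf_le_left)
  have heven := eventually_strictDec_conj (l := atTop ⊓ 𝓟 {i | ¬ i % 2 = 1}) (N := N) hkg h.turns
    hθ h.abs_le hrθ hg1' hg0' (hK₁.trans_le hle₁) hNd (hdet.filter_mono inf_le_left)
    (by
      rw [eventually_inf_principal]
      filter_upwards [eventually_ge_atTop 1] with i hi hi2
      have := hS i hi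
      rwa [if_neg hi2] at this) (hlim.mono_left inf_le_left)
  rw [eventually_inf_principal] at hodd heven
  obtain ⟨i₀, hi₀⟩ := eventually_atTop.1 (hodd.and heven)
  refine ⟨n, g, k, r, max i₀ 1, hn, le_max_right _ _, h, hk, hgk, hkg, fun i hi => ?_⟩
  obtain ⟨ho, he⟩ := hi₀ i ((le_max_left _ _).trans hi)
  by_cases hi2 : i % 2 = 1
  · exact ho hi2
  · exact he hi2

theorem exists_word_of_strictDec {A : M2} (hA : InGL2Z A)
    (h : StrictDec (A 0 0) (A 0 1) (A 1 0) (A 1 1) ∨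
      StrictDec (-A 0 0) (-A 0 1) (-A 1 0) (-A 1 1)) :
    ∃ u, wordMat u = A ∨ wordMat u = -A := by
  obtain h | h := h
  · obtain ⟨h1, h2, h3, h4, h5⟩ := h
    norm_cast at h1 h2 h3 h4 h5
    obtain ⟨u, hu⟩ := exists_wordMat_eq hA h1.le h2.le h3.le h4.le h5.le
    exact ⟨u, Or.inl hu⟩
  · obtain ⟨h1, h2, h3, h4, h5⟩ := h
    norm_cast at h1 h2 h3 h4 h5
    have hA' : InGL2Z (-A) := by
      have e : (-A).det = A.det := by simp [Matrix.det_fin_two]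
      rwa [InGL2Z, e]
    obtain ⟨u, hu⟩ := exists_wordMat_eq hA' h1.le h2.le h3.le h4.le h5.le
    exact ⟨u, Or.inr hu⟩

theorem StrictDec.ne_zero_right {a b c d : ℝ} (h : StrictDec a b c d ∨
    StrictDec (-a) (-b) (-c) (-d)) : c ≠ 0 := by
  rintro rfl
  obtain h | h := h <;> obtain ⟨h1, -, h3, -, -⟩ := h <;> linarith

theorem wordMat_eq_of_eq_or_neg {u v : List ℕ+} (h : wordMat u = wordMat v ∨
    wordMat u = -wordMat v) : u = v := by
  obtain h | h := h
  · exact wordMat_injective h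
  · have h1 := (wordMat_weak u).1
    have h2 := (wordMat_weak v).1
    rw [h, Matrix.neg_apply] at h1
    omega

theorem wordMat_fib {u v w : List ℕ+} {A B : M2} (hu : wordMat u = A ∨ wordMat u = -A)
    (hv : wordMat v = B ∨ wordMat v = -B) (hw : wordMat w = A * B ∨ wordMat w = -(A * B)) :
    w = u ++ v := by
  refine wordMat_eq_of_eq_or_neg ?_
  rw [wordMat_append]
  rcases hu with hu | hu <;> rcases hv with hv | hv <;> rcases hw with hw | hw <;>
    simp [hu, hv, hw]

open Filter Topology in
/-- A Fibonacci sequence of words whose matrices are conjugate, up to sign, to a tail of `W`. -/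
theorem exists_fibWordSeq {ξ : ℝ} {N : M2} {W : ℕ → M2} (hξ : Irrational ξ)
    (hG : ∀ i, 1 ≤ i → InGL2Z (W i)) (hrec : ∀ i, 1 ≤ i → W (i + 2) = W (i + 1) * W i)
    (hlim : Tendsto (fun i => xiNorm ξ (W i)) atTop (𝓝 0))
    (hquad : ∀ a b c : ℤ, a * ξ ^ 2 + b * ξ + c = 0 → a = 0 ∧ b = 0 ∧ c = 0)
    (hNd : N.det ≠ 0) (hN : N ≠ -Nᵀ)
    (hS : ∀ i, 1 ≤ i → (W i * (if i % 2 = 1 then Nᵀ else N)).IsSymm) :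
    ∃ (n : ℕ) (w : ℕ → List ℕ+), 1 ≤ n ∧ FibWordSeq w ∧ w 1 ++ w 2 ≠ w 2 ++ w 1 ∧
      Tendsto (fun i => (wordMat (w i) 0 0 : ℝ) - cq n ξ * wordMat (w i) 1 0) atTop (𝓝 0) := by
  obtain ⟨n, g, k, r, i₀, hn, hi₀, hg, hk, hgk, hkg, hdec⟩ :=
    exists_strictDec_conj hξ hG hlim hquad hNd hN hS
  have hex : ∀ i, ∃ u, i₀ ≤ i → wordMat u = k * W i * g ∨ wordMat u = -(k * W i * g) := by
    intro i
    by_cases hi : i₀ ≤ i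
    · obtain ⟨u, hu⟩ := exists_word_of_strictDec
        ((hk.mul (hG i (by omega))).mul hg.unim) (hdec i hi)
      exact ⟨u, fun _ => hu⟩
    · exact ⟨[], fun h => absurd h hi⟩
  choose u hu using hex
  have hconj : ∀ A B : M2, k * (A * B) * g = k * A * g * (k * B * g) := conj_mul_conj hgk
  refine ⟨n, fun i => u (i + i₀), hn, ?_, ?_, ?_⟩
  · intro i hi
    have h2 := hu (i + i₀ + 2) (by omega)
    rw [hrec _ (by omega), hconj] at h2
    beta_reduce
    rw [Nat.add_right_comm i 2, Nat.add_right_comm i 1]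
    exact wordMat_fib (hu (i + i₀ + 1) (by omega)) (hu (i + i₀) (by omega)) h2
  · intro hc
    have hc' := congrArg wordMat hc
    rw [wordMat_append, wordMat_append] at hc'
    have hM : k * W (1 + i₀) * g * (k * W (2 + i₀) * g) =
        k * W (2 + i₀) * g * (k * W (1 + i₀) * g) := by
      rcases hu (1 + i₀) (by omega) with h1 | h1 <;> rcases hu (2 + i₀) (by omega) with h2 | h2 <;>
        simpa [h1, h2] using hc'
    rw [← hconj, ← hconj] at hM
    have hW : Commute (W (1 + i₀)) (W (1 + i₀ + 1)) := by
      rw [show 1 + i₀ + 1 = 2 + i₀ by ring]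
      have h1 := congrArg (fun X => g * X * k) hM
      simp only [conj_conj hgk] at h1
      exact h1
    have hs := eq_scalar_of_commute hG hrec hlim hquad (by omega) hW
    have hd := StrictDec.ne_zero_right (hdec (1 + i₀) (by omega))
    rw [hs, Matrix.mul_smul, Matrix.mul_one, Matrix.smul_mul, hkg] at hd
    simp at hd
  · have hlim' : Tendsto (fun i => xiNorm ξ (W (i + i₀))) atTop (𝓝 0) :=
      (tendsto_add_atTop_iff_nat i₀).2 hlim
    have hbd : ∀ i, |(wordMat (u (i + i₀)) 0 0 : ℝ) - cq n ξ * wordMat (u (i + i₀)) 1 0| ≤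
        |r|⁻¹ * (2 * xiNorm ξ (W (i + i₀)) * mnorm g) := by
      intro i
      have hx : |ξ * ((W (i + i₀) * g) 0 0 : ℝ) - (W (i + i₀) * g) 1 0| ≤
          2 * xiNorm ξ (W (i + i₀)) * mnorm g :=
        (le_max_left _ _).trans (xiNorm_mul_le ξ (W (i + i₀)) g)
      have hgM : g * (k * W (i + i₀) * g) = W (i + i₀) * g := by
        rw [← Matrix.mul_assoc, ← Matrix.mul_assoc, hgk, Matrix.one_mul]
      have e : ∀ (X Y : M2) a b, (X * Y) a b = X a 0 * Y 0 b + X a 1 * Y 1 b :=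
        fun X Y a b => by rw [Matrix.mul_apply, Fin.sum_univ_two]
      have hxM : ξ * ((W (i + i₀) * g) 0 0 : ℝ) - (W (i + i₀) * g) 1 0 =
          r * ((k * W (i + i₀) * g) 0 0 - cq n ξ * (k * W (i + i₀) * g) 1 0) := by
        rw [← hgM, e g, e g]
        push_cast
        linear_combination ((k * W (i + i₀) * g) 0 0 : ℝ) * hg.turns.fst +
          ((k * W (i + i₀) * g) 1 0 : ℝ) * hg.turns.snd
      rw [hxM, abs_mul] at hx
      rw [inv_mul_eq_div, le_div_iff₀' (abs_pos.2 hg.ne_zero)]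
      refine le_trans (le_of_eq ?_) hx
      congr 1
      rcases hu (i + i₀) (by omega) with h | h
      · rw [h]
      · rw [h, ← abs_neg]
        congr 1
        simp
        ring
    refine squeeze_zero_norm hbd ?_
    simpa using (((hlim'.const_mul 2).mul_const (mnorm g)).const_mul |r|⁻¹)

open Filter Topology in
/-- If the columns of the products starting with `u` approach the direction of `θ`,
then the letters of `u` are the first partial quotients of `θ`. -/
theorem cfA_eq_of_tendsto {u : List ℕ+} {θ : ℝ} {y : ℕ → List ℕ+} (hθ : Irrational θ)
    (h : Tendsto (fun m => (wordMat (u ++ y m) 0 0 : ℝ) - θ * wordMat (u ++ y m) 1 0)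
      atTop (𝓝 0)) (j : ℕ) (hj : j < u.length) : cfA j θ = ((u.get ⟨j, hj⟩ : ℕ) : ℤ) := by
  induction u generalizing θ j with
  | nil => simp at hj
  | cons a u ih =>
    obtain ⟨B, hB⟩ : ∃ B : ℕ → M2, ∀ m, B m = wordMat (u ++ y m) := ⟨_, fun _ => rfl⟩
    have hA : ∀ m, (wordMat (a :: u ++ y m) 0 0 : ℝ) - θ * wordMat (a :: u ++ y m) 1 0 =
        (B m 1 0 : ℝ) - (θ - (a : ℕ)) * B m 0 0 := by
      intro m
      rw [List.cons_append, (wordMat_cons_entries a _).1, (wordMat_cons_entries a _).2.2.1, ← hB]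
      push_cast
      ring
    simp only [hA] at h
    have hw : ∀ m, (1 : ℝ) ≤ B m 0 0 ∧ (0 : ℝ) ≤ B m 1 0 ∧ (B m 1 0 : ℝ) ≤ B m 0 0 := by
      intro m
      obtain ⟨h1, h2, h3, -⟩ := wordMat_weak (u ++ y m)
      rw [← hB] at h1 h2 h3
      exact ⟨by exact_mod_cast h1, by exact_mod_cast h2, by exact_mod_cast h3⟩
    have hirr : Irrational (θ - (a : ℕ)) := hθ.sub_natCast _
    have hlow : 0 ≤ θ - (a : ℕ) := by
      refine le_of_forall_pos_lt_add fun ε hε => ?_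
      obtain ⟨m, hm⟩ := (h.eventually (gt_mem_nhds hε)).exists
      by_contra! hc
      nlinarith [hw m]
    have hup : θ - (a : ℕ) ≤ 1 := by
      refine le_of_forall_pos_lt_add fun ε hε => ?_
      obtain ⟨m, hm⟩ := (h.eventually (lt_mem_nhds (neg_lt_zero.2 hε))).exists
      by_contra! hc
      nlinarith [hw m]
    have hlow' : 0 < θ - (a : ℕ) := lt_of_le_of_ne hlow (by simpa using (hirr.ne_nat 0).symm)
    have hup' : θ - (a : ℕ) < 1 := lt_of_le_of_ne hup (by simpa using hirr.ne_nat 1)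
    have hfl : ⌊θ⌋ = ((a : ℕ) : ℤ) := by
      rw [Int.floor_eq_iff]
      push_cast
      constructor <;> linarith
    cases j with
    | zero => simpa [cfA] using hfl
    | succ j =>
      have hfl' : (⌊θ⌋ : ℝ) = (a : ℕ) := by rw [hfl]; simp
      rw [cfA, hfl']
      refine ih hirr.inv ?_ j (by simpa using hj)
      have := h.const_mul (-(θ - (a : ℕ))⁻¹)
      rw [mul_zero] at this
      convert this using 2 with m
      rw [hB]
      field_simp
      ring

theorem FibWordSeq.exists_append {α : Type} {w : ℕ → List α} (hw : FibWordSeq w) {k : ℕ} (hk : 2 ≤ k)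
    (m : ℕ) : ∃ y, w (m + k) = w k ++ y := by
  induction m with
  | zero => exact ⟨[], by simp⟩
  | succ m ih =>
    obtain ⟨y, hy⟩ := ih
    refine ⟨y ++ w (m + k - 1), ?_⟩
    have := hw (m + k - 1) (by omega)
    rw [show m + k - 1 + 2 = m + 1 + k by omega, show m + k - 1 + 1 = m + k by omega, hy] at this
    rw [this, List.append_assoc]

theorem FibWordSeq.le_length {α : Type} {w : ℕ → List α} (hw : FibWordSeq w)
    (hcom : w 1 ++ w 2 ≠ w 2 ++ w 1) (n : ℕ) :
    n ≤ (w (n + 2)).length ∧ 0 < (w (n + 1)).length ∧ 0 < (w (n + 2)).length := by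
  induction n with
  | zero =>
    refine ⟨by simp, List.length_pos_iff.2 fun h => hcom ?_, List.length_pos_iff.2 fun h => hcom ?_⟩
    · rw [h]; simp
    · rw [h]; simp
  | succ n ih =>
    have := congrArg List.length (hw (n + 1) (by omega))
    rw [List.length_append, show w (n + 1 + 1) = w (n + 2) from rfl] at this
    refine ⟨?_, ih.2.2, ?_⟩ <;> omega

open Filter Topology in
theorem exists_limit_word_of_extremal {ξ : ℝ} {W : ℕ → M2} (hξ : Irrational ξ)
    (hext : IsExtremal ξ) (hW : IsAssociated ξ W) (hG : ∀ i, 1 ≤ i → InGL2Z (W i)) :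
    ∃ (w : ℕ → List ℕ+) (b : ℕ → ℕ+) (k l : ℕ),
      FibWordSeq w ∧ w 1 ++ w 2 ≠ w 2 ++ w 1 ∧ IsLimitWord w b ∧
      ∀ i, 1 ≤ i → cfA (k + i) ξ = ((b (l + i) : ℕ) : ℤ) := by
  obtain ⟨⟨-, hrec⟩, hub, ⟨N, hNP, -, hN, hS⟩, c₁, c₂, c₃, c₄, c₅, c₆, hc₁, -, -, -, -, -, hc⟩ := hW
  have hrec' : ∀ i, 1 ≤ i → W (i + 2) = W (i + 1) * W i := fun i hi => by
    rw [hrec i hi, pmul_of_inGL2Z (hG _ (by omega)) (hG _ hi)]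
  have hquad : ∀ a b c : ℤ, a * ξ ^ 2 + b * ξ + c = 0 → a = 0 ∧ b = 0 ∧ c = 0 := by
    intro a b c h
    by_contra hne
    refine hext.1 a b c (fun h0 => hne ?_) (by exact_mod_cast h)
    exact_mod_cast h0
  have hlim : Tendsto (fun i => xiNorm ξ (W i)) atTop (𝓝 0) := by
    have h0 := (tendsto_mnorm_atTop hub hc₁ fun i hi => (hc i hi).1).inv_tendsto_atTop.const_mul c₄
    rw [mul_zero] at h0
    refine tendsto_of_tendsto_of_tendsto_of_le_of_le' tendsto_const_nhds h0
      (Eventually.of_forall fun i => xiNorm_nonneg _ _) ?_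
    filter_upwards [eventually_ge_atTop 1] with i hi using (hc i hi).2.2.2.1
  obtain ⟨n, w, hn, hfib, hcom, htend⟩ :=
    exists_fibWordSeq hξ hG hrec' hlim hquad hNP.2 hN hS
  have hcf : ∀ k, 2 ≤ k → ∀ j (hj : j < (w k).length),
      cfA j (cq n ξ) = (((w k).get ⟨j, hj⟩ : ℕ) : ℤ) := by
    intro k hk j hj
    choose y hy using hfib.exists_append hk
    refine cfA_eq_of_tendsto (y := y) (hξ.cq n) ?_ j hj
    have := (tendsto_add_atTop_iff_nat k).2 htend
    simpa only [hy] using this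
  have hpos : ∀ j, 0 < (cfA j (cq n ξ)).toNat := by
    intro j
    have := hξ.one_le_cfA (n := n + j) (by omega)
    rw [cfA_add] at this
    omega
  have hval : ∀ j, ((cfA j (cq n ξ)).toNat : ℤ) = cfA j (cq n ξ) := fun j => by
    have := hpos j
    omega
  refine ⟨w, fun j => ⟨(cfA (j - 1) (cq n ξ)).toNat, hpos _⟩, n - 1, 0, hfib, hcom, ⟨?_, ?_⟩, ?_⟩
  · exact fun m => ⟨m + 2, by omega, (hfib.le_length hcom m).1⟩
  · intro k hk j hj
    apply PNat.eq
    have := hcf k hk j hj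
    rw [← hval] at this
    simpa using (by exact_mod_cast this.symm :
      ((w k).get ⟨j, hj⟩ : ℕ) = (cfA j (cq n ξ)).toNat)
  · intro i hi
    rw [show n - 1 + i = n + (i - 1) by omega, Nat.zero_add, cfA_add]
    simp only [PNat.mk_coe, hval]

/-- An irrational real ξ is extremal with an associated Fibonacci sequence in GL₂(ℤ) iff its
sequence of partial quotients coincides, up to first terms, with the limit of a Fibonacci
sequence of words over the positive integers starting with two non-commuting words. -/
theorem stmt3 (ξ : ℝ) (hirr : Irrational ξ) :
    (IsExtremal ξ ∧ ∃ W : ℕ → M2, IsAssociated ξ W ∧ ∀ i, 1 ≤ i → InGL2Z (W i)) ↔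
    (∃ (w : ℕ → List ℕ+) (b : ℕ → ℕ+) (k l : ℕ),
      FibWordSeq w ∧ w 1 ++ w 2 ≠ w 2 ++ w 1 ∧ IsLimitWord w b ∧
      ∀ i, 1 ≤ i → cfA (k + i) ξ = ((b (l + i) : ℕ) : ℤ)) :=
  ⟨fun ⟨hext, _, hW, hG⟩ => exists_limit_word_of_extremal hirr hext hW hG,
    fun ⟨_, _, _, _, hw, hcom, hlim, h⟩ => extremal_of_limit_word hirr hw hcom hlim h⟩
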